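/- Suppose n is even. For every ε > 0 there exists C > 0 such that the following holds: if t = t(n) and b = b(n) satisfy t ≥ C·n·log n and b ≥ (1+ε)·n/2, then there exists a (t,b)-strategy B of Builder such that the probability that the purchased graph B_t contains a perfect matching tends to 1 as n → ∞. -/

import Mathlib

open Filter

attribute [local instance] Classical.propDecidable

/-- The edges of the complete graph on `Fin n`: non-diagonal unordered pairs. -/
abbrev CEdge (n : ℕ) : Type := {e : Sym2 (Fin n) // ¬ e.IsDiag}

/-- The sample space: a uniformly random ordering of the edges of `K_n`,
encoded as a bijection from positions to edges. -/
abbrev EdgeOrdering (n : ℕ) : Type := Fin (Fintype.card (CEdge n)) ≃ CEdge n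

/-- The uniform probability of an event on a finite sample space. -/
noncomputable def uprob {α : Type} [Fintype α] (P : α → Prop) : ℝ :=
  ((Finset.univ.filter P).card : ℝ) / (Fintype.card α : ℝ)

/-- A (deterministic) strategy of Builder: given the current time `s`, the graph `B_{s-1}`
of previously purchased edges, and the observed edge `e_s`, decide whether to purchase it. -/
def Strategy (n : ℕ) : Type := ℕ → Finset (CEdge n) → CEdge n → Bool

/-- Builder's purchased graph `B_s` at time `s`, playing strategy `S` with budget `b`
on the ordering `ω`.  An edge is purchased iff the strategy accepts it and the budget permits. -/
noncomputable def build (n b : ℕ) (S : Strategy n) (ω : EdgeOrdering n) : ℕ → Finset (CEdge n)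
  | 0 => ∅
  | s + 1 =>
    let P := build n b S ω s
    if h : s < Fintype.card (CEdge n) then
      if S s P (ω ⟨s, h⟩) = true ∧ P.card < b then insert (ω ⟨s, h⟩) P else P
    else P

/-- The degree of the vertex `v` in the graph given by the edge set `P`. -/
noncomputable def edegree (n : ℕ) (P : Finset (CEdge n)) (v : Fin n) : ℕ :=
  (P.filter (fun e => v ∈ (e : Sym2 (Fin n)))).card


/-- The edge set `P` contains a perfect matching: a subset `M` of edges such that every
vertex lies in exactly one edge of `M`. -/
def hasPerfectMatching (n : ℕ) (P : Finset (CEdge n)) : Prop :=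
  ∃ M : Finset (CEdge n), M ⊆ P ∧
    ∀ v : Fin n, ∃! e : CEdge n, e ∈ M ∧ v ∈ (e : Sym2 (Fin n))

/-! ### Counting bijections and averaging over group actions -/

/-- Among the bijections `α ≃ β`, the proportion of those mapping `s` into `t` is at most
`(|t| / |β|) ^ |s|`. -/
theorem card_equiv_mapsTo_le {α β : Type} [Fintype α] [Fintype β]
    (h : Fintype.card α = Fintype.card β) (s : Finset α) (t : Finset β) :
    ((Finset.univ.filter (fun σ : α ≃ β => ∀ x ∈ s, σ x ∈ t)).card : ℝ) ≤
      ((t.card : ℝ) / Fintype.card β) ^ s.card * Fintype.card (α ≃ β) := by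
  induction s using Finset.induction_on with
  | empty => simp [Finset.card_univ]
  | insert x s hx ih =>
    set N : Finset α → Finset (α ≃ β) :=
      fun s => Finset.univ.filter (fun σ : α ≃ β => ∀ x ∈ s, σ x ∈ t) with hN
    have hpos : 0 < Fintype.card β := by
      rw [← h]; exact Fintype.card_pos_iff.mpr ⟨x⟩
    have key : Fintype.card β * (N (insert x s)).card ≤ (N s).card * t.card := by
      have h1 : ∑ σ ∈ N s, (Finset.univ.filter (fun y : α => σ y ∈ t)).card
          = (N s).card * t.card := by
        rw [Finset.sum_const_nat]
        intro σ _
        rw [← Finset.card_map σ.toEmbedding]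
        congr 1
        ext z
        simp only [Finset.mem_map, Finset.mem_filter, Finset.mem_univ, true_and,
          Equiv.coe_toEmbedding]
        constructor
        · rintro ⟨y, hy, rfl⟩; exact hy
        · intro hz; exact ⟨σ.symm z, by simpa using hz, by simp⟩
      have h2 : ∑ σ ∈ N s, (Finset.univ.filter (fun y : α => σ y ∈ t)).card
          = ∑ y : α, ((N s).filter (fun σ => σ y ∈ t)).card :=
        Finset.sum_card_bipartiteAbove_eq_sum_card_bipartiteBelow (fun (σ : α ≃ β) y => σ y ∈ t)
      have h3 : ∀ y : α, (N (insert x s)).card ≤ ((N s).filter (fun σ => σ y ∈ t)).card := by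
        intro y
        by_cases hy : y ∈ s
        · apply Finset.card_le_card
          intro σ hσ
          simp only [hN, Finset.mem_filter, Finset.mem_univ, true_and, Finset.mem_insert,
            forall_eq_or_imp] at hσ ⊢
          exact ⟨hσ.2, hσ.2 y hy⟩
        · apply Finset.card_le_card_of_injOn (fun σ => (Equiv.swap x y).trans σ)
          · intro σ hσ
            simp only [hN, Finset.coe_filter, Finset.mem_filter, Finset.mem_univ, true_and,
              Finset.mem_insert, forall_eq_or_imp, Set.mem_ofPred_eq, Equiv.trans_apply,
              Equiv.swap_apply_right] at hσ ⊢
            refine ⟨fun z hz => ?_, hσ.1⟩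
            rw [Equiv.swap_apply_of_ne_of_ne (by rintro rfl; exact hx hz)
              (by rintro rfl; exact hy hz)]
            exact hσ.2 z hz
          · intro σ _ τ _ hστ
            ext z
            have := congrArg (fun f : α ≃ β => f (Equiv.swap x y z)) hστ
            simpa using this
      calc Fintype.card β * (N (insert x s)).card
          = ∑ _y : α, (N (insert x s)).card := by simp [h]
        _ ≤ ∑ y : α, ((N s).filter (fun σ => σ y ∈ t)).card :=
            Finset.sum_le_sum fun y _ => h3 y
        _ = _ := by rw [← h2, h1]
    have hb : (0 : ℝ) < Fintype.card β := by exact_mod_cast hpos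
    have key' : (Fintype.card β : ℝ) * (N (insert x s)).card ≤ (N s).card * t.card := by
      exact_mod_cast key
    rw [Finset.card_insert_of_notMem hx, pow_succ]
    calc ((N (insert x s)).card : ℝ) ≤ (N s).card * t.card / Fintype.card β := by
          rw [le_div_iff₀ hb]; linarith
      _ = (N s).card * ((t.card : ℝ) / Fintype.card β) := by ring
      _ ≤ (((t.card : ℝ) / Fintype.card β) ^ s.card * Fintype.card (α ≃ β))
            * ((t.card : ℝ) / Fintype.card β) :=
          mul_le_mul_of_nonneg_right ih (by positivity)
      _ = _ := by ring

/-- If, along every orbit of a family `act` of injective self-maps preserving `X`, the proportion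
of parameters leading to `E` is at most `x`, then `E` has density at most `x` inside `X`. -/
theorem card_filter_le_of_average {Ω Γ : Type} [Fintype Ω] [Fintype Γ] [Nonempty Γ]
    (act : Γ → Ω → Ω) (hact : ∀ g, Function.Injective (act g)) (E X : Ω → Prop)
    (hX : ∀ g ω, E (act g ω) → X ω) (x : ℝ)
    (h : ∀ ω, X ω →
      ((Finset.univ.filter (fun g => E (act g ω))).card : ℝ) ≤ x * Fintype.card Γ) :
    ((Finset.univ.filter E).card : ℝ) ≤ x * (Finset.univ.filter X).card := by
  have hΓ : (0 : ℝ) < Fintype.card Γ := by exact_mod_cast Fintype.card_pos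
  have h1 : ∀ g : Γ, (Finset.univ.filter (fun ω => E (act g ω))).card
      = (Finset.univ.filter E).card := by
    intro g
    apply Finset.card_bij (fun ω _ => act g ω)
    · intro ω hω; simpa using hω
    · intro a _ b _ hab; exact hact g hab
    · intro ω hω
      obtain ⟨ω', rfl⟩ := (Finite.injective_iff_surjective.mp (hact g)) ω
      exact ⟨ω', by simpa using hω, rfl⟩
  have h2 : ∑ g : Γ, (Finset.univ.filter (fun ω => E (act g ω))).card
      = ∑ ω : Ω, (Finset.univ.filter (fun g => E (act g ω))).card :=
    Finset.sum_card_bipartiteAbove_eq_sum_card_bipartiteBelow (fun g ω => E (act g ω))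
  have h3 : (Fintype.card Γ : ℝ) * (Finset.univ.filter E).card
      = ∑ ω : Ω, ((Finset.univ.filter (fun g => E (act g ω))).card : ℝ) := by
    rw [← Nat.cast_sum, ← h2, Finset.sum_congr rfl (fun g _ => h1 g)]
    simp
  have h4 : ∑ ω : Ω, ((Finset.univ.filter (fun g => E (act g ω))).card : ℝ)
      ≤ ∑ ω ∈ Finset.univ.filter X, x * Fintype.card Γ := by
    rw [Finset.sum_filter]
    apply Finset.sum_le_sum
    intro ω _
    split_ifs with hω
    · exact h ω hω
    · have : Finset.univ.filter (fun g => E (act g ω)) = ∅ := by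
        ext g
        simpa using fun hg => hω (hX g ω hg)
      simp [this]
  rw [Finset.sum_const, nsmul_eq_mul, ← h3] at h4
  nlinarith

theorem uprob_eq {α : Type} [Fintype α] (P : α → Prop) [DecidablePred P] :
    uprob P = ((Finset.univ.filter P).card : ℝ) / Fintype.card α := by
  unfold uprob; congr!

theorem uprob_nonneg {α : Type} [Fintype α] (P : α → Prop) : 0 ≤ uprob P := by
  unfold uprob; positivity

theorem uprob_le_one {α : Type} [Fintype α] (P : α → Prop) : uprob P ≤ 1 := by
  unfold uprob
  apply div_le_one_of_le₀ _ (by positivity)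
  exact_mod_cast Finset.card_filter_le _ _

theorem uprob_mono {α : Type} [Fintype α] {P Q : α → Prop} (h : ∀ a, P a → Q a) :
    uprob P ≤ uprob Q := by
  unfold uprob
  apply div_le_div_of_nonneg_right _ (by positivity)
  exact_mod_cast Finset.card_le_card (Finset.monotone_filter_right _ (fun a _ => h a))

theorem uprob_or_le {α : Type} [Fintype α] (P Q : α → Prop) :
    uprob (fun a => P a ∨ Q a) ≤ uprob P + uprob Q := by
  rw [uprob_eq, uprob_eq P, uprob_eq Q, ← add_div, Finset.filter_or]
  apply div_le_div_of_nonneg_right _ (by positivity)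
  exact_mod_cast Finset.card_union_le _ _

theorem uprob_exists_mem_le {α ι : Type} [Fintype α] (I : Finset ι) (P : ι → α → Prop) :
    uprob (fun a => ∃ i ∈ I, P i a) ≤ ∑ i ∈ I, uprob (P i) := by
  rw [uprob_eq]
  simp only [uprob_eq (P _)]
  rw [← Finset.sum_div]
  apply div_le_div_of_nonneg_right _ (by positivity)
  have : Finset.univ.filter (fun a => ∃ i ∈ I, P i a)
      ⊆ I.biUnion (fun i => Finset.univ.filter (P i)) := by
    intro a; simp
  exact_mod_cast (Finset.card_le_card this).trans Finset.card_biUnion_le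

theorem uprob_exists_le {α ι : Type} [Fintype α] (I : Finset ι) (P : ι → α → Prop) (x : ℝ)
    (h : ∀ i ∈ I, uprob (P i) ≤ x) :
    uprob (fun a => ∃ i ∈ I, P i a) ≤ I.card * x := by
  refine (uprob_exists_mem_le I P).trans ((Finset.sum_le_sum h).trans ?_)
  simp

theorem one_sub_le_uprob {α : Type} [Fintype α] [Nonempty α] {P Q : α → Prop}
    (h : ∀ a, ¬ P a → Q a) : 1 - uprob Q ≤ uprob P := by
  have h1 : uprob (fun a => P a ∨ Q a) = 1 := by
    have : ∀ a, P a ∨ Q a := fun a => or_iff_not_imp_left.mpr (h a)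
    unfold uprob
    simp [this]
  linarith [uprob_or_le P Q]

theorem uprob_mapsTo_le {α β : Type} [Fintype α] [Fintype β] [inst : Fintype (α ≃ β)]
    (h : Fintype.card α = Fintype.card β) (s : Finset α) (t : Finset β) :
    @uprob _ inst (fun σ : α ≃ β => ∀ x ∈ s, σ x ∈ t) ≤
      ((t.card : ℝ) / Fintype.card β) ^ s.card := by
  obtain rfl : inst = Equiv.instFintype := Subsingleton.elim _ _
  rw [uprob_eq]
  have : Nonempty (α ≃ β) := ⟨Fintype.equivOfCardEq h⟩
  rw [div_le_iff₀ (by exact_mod_cast Fintype.card_pos)]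
  exact card_equiv_mapsTo_le h s t

theorem uprob_le_of_average {Ω Γ : Type} [Fintype Ω] [Fintype Γ] [Nonempty Γ]
    (act : Γ → Ω → Ω) (hact : ∀ g, Function.Injective (act g)) (E X : Ω → Prop)
    (hX : ∀ g ω, E (act g ω) → X ω) (x : ℝ)
    (h : ∀ ω, X ω → uprob (fun g => E (act g ω)) ≤ x) :
    uprob E ≤ x * uprob X := by
  have hΓ : (0 : ℝ) < Fintype.card Γ := by exact_mod_cast Fintype.card_pos
  unfold uprob at h ⊢
  rw [← mul_div_assoc]
  apply div_le_div_of_nonneg_right _ (by positivity)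
  refine card_filter_le_of_average act hact E X hX x fun ω hω => ?_
  rw [← div_le_iff₀ hΓ]
  exact h ω hω

/-- In a uniformly random family of permutations, independent coordinates multiply. -/
theorem uprob_pi_mapsTo_le {α β : Type} [Fintype α] [Fintype β]
    [inst : Fintype (α → Equiv.Perm β)] (S : Finset α)
    (s : α → Finset β) (K : ℕ) (hs : ∀ a ∈ S, (s a).card = K) (t : Finset β) :
    @uprob _ inst (fun g : α → Equiv.Perm β => ∀ a ∈ S, ∀ x ∈ s a, g a x ∈ t) ≤
      ((t.card : ℝ) / Fintype.card β) ^ (K * S.card) := by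
  have h1 : Finset.univ.filter (fun g : α → Equiv.Perm β => ∀ a ∈ S, ∀ x ∈ s a, g a x ∈ t)
      = Fintype.piFinset (fun a => Finset.univ.filter
          (fun σ : Equiv.Perm β => a ∈ S → ∀ x ∈ s a, σ x ∈ t)) := by
    ext g; simp
  obtain rfl : inst = Pi.instFintype := Subsingleton.elim _ _
  rw [uprob_eq, h1, Fintype.card_piFinset, Fintype.card_pi, Nat.cast_prod, Nat.cast_prod,
    ← Finset.prod_div_distrib]
  calc _ ≤ ∏ a : α, (if a ∈ S then ((t.card : ℝ) / Fintype.card β) ^ K else 1) := by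
        apply Finset.prod_le_prod
        · intro a _; positivity
        · intro a _
          split_ifs with ha
          · have := uprob_mapsTo_le (rfl : Fintype.card β = Fintype.card β) (s a) t
            rw [hs a ha] at this
            simpa [uprob_eq, ha] using this
          · exact (uprob_eq _).symm.trans_le (uprob_le_one _)
    _ = _ := by
        rw [Finset.prod_ite_mem, Finset.univ_inter, Finset.prod_const, pow_mul]

/-! ### Perfect matchings from Hall's condition -/

/-- If small sets on both sides of a balanced bipartite graph expand, then Hall's condition
holds. -/
theorem card_le_card_nbhd_of_half {V : Type} (r : V → V → Prop) (A B : Finset V) (k : ℕ)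
    (hAk : A.card = k) (hBk : B.card = k)
    (hA : ∀ S ⊆ A, ∀ T ⊆ B, 2 * S.card ≤ k + 1 → T.card + 1 = S.card →
      ∃ a ∈ S, ∃ b ∈ B \ T, r a b)
    (hB : ∀ S ⊆ B, ∀ T ⊆ A, 2 * S.card ≤ k + 1 → T.card + 1 = S.card →
      ∃ b ∈ S, ∃ a ∈ A \ T, r a b) :
    ∀ S ⊆ A, S.card ≤ (B.filter (fun b => ∃ a ∈ S, r a b)).card := by
  intro S hS
  by_contra! hlt
  set N := B.filter (fun b => ∃ a ∈ S, r a b) with hN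
  have hSk : S.card ≤ k := hAk ▸ Finset.card_le_card hS
  have hNB : N ⊆ B := Finset.filter_subset _ _
  by_cases h2 : 2 * S.card ≤ k + 1
  · obtain ⟨T, hNT, hTB, hT⟩ := Finset.exists_subsuperset_card_eq hNB
      (show N.card ≤ S.card - 1 by omega) (by omega)
    obtain ⟨a, ha, b, hb, hr⟩ := hA S hS T hTB h2 (by omega)
    rw [Finset.mem_sdiff] at hb
    exact hb.2 (hNT (Finset.mem_filter.mpr ⟨hb.1, a, ha, hr⟩))
  · have h3 : (B \ N).card = k - N.card := by rw [Finset.card_sdiff_of_subset hNB, hBk]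
    obtain ⟨S', hS', hS'c⟩ := Finset.exists_subset_card_eq
      (show k - S.card + 1 ≤ (B \ N).card by omega)
    have h4 : (A \ S).card = k - S.card := by rw [Finset.card_sdiff_of_subset hS, hAk]
    obtain ⟨b, hb, a, ha, hr⟩ := hB S' (hS'.trans Finset.sdiff_subset) (A \ S)
      Finset.sdiff_subset (by omega) (by omega)
    have hb' := Finset.mem_sdiff.mp (hS' hb)
    rw [Finset.sdiff_sdiff_eq_self hS] at ha
    exact hb'.2 (Finset.mem_filter.mpr ⟨hb'.1, a, ha, hr⟩)

/-- The edge `e` joins the two colour classes of `c`. -/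
def Crossing {n : ℕ} (c : Fin n → Bool) (e : CEdge n) : Prop :=
  ∃ a ∈ (e : Sym2 (Fin n)), ∃ b ∈ (e : Sym2 (Fin n)), c a ≠ c b

/-- The vertices not covered by monochromatic edges of `P`. -/
noncomputable def free {n : ℕ} (c : Fin n → Bool) (P : Finset (CEdge n)) : Finset (Fin n) :=
  Finset.univ.filter (fun v => ∀ e ∈ P, v ∈ (e : Sym2 (Fin n)) → Crossing c e)

/-- The vertices of colour `i` not covered by monochromatic edges of `P`. -/
noncomputable def freeSide {n : ℕ} (c : Fin n → Bool) (P : Finset (CEdge n)) (i : Bool) :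
    Finset (Fin n) :=
  (free c P).filter (fun v => c v = i)

/-- `a` and `b` are joined by an edge of `P`. -/
def EdgeAdj {n : ℕ} (P : Finset (CEdge n)) (a b : Fin n) : Prop :=
  ∃ e ∈ P, (e : Sym2 (Fin n)) = s(a, b)

theorem EdgeAdj.symm {n : ℕ} {P : Finset (CEdge n)} {a b : Fin n} (h : EdgeAdj P a b) :
    EdgeAdj P b a := by
  obtain ⟨e, he, h⟩ := h
  exact ⟨e, he, h.trans Sym2.eq_swap⟩

/-- The number of edges of `P` at `v`. -/
noncomputable def cdegree {n : ℕ} (P : Finset (CEdge n)) (v : Fin n) : ℕ :=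
  (P.filter (fun e : CEdge n => v ∈ (e : Sym2 (Fin n)))).card

theorem crossing_iff {n : ℕ} {c : Fin n → Bool} {e : CEdge n} {a b : Fin n}
    (h : (e : Sym2 (Fin n)) = s(a, b)) : Crossing c e ↔ c a ≠ c b := by
  unfold Crossing
  rw [h]
  simp only [Sym2.mem_iff]
  constructor
  · rintro ⟨x, rfl | rfl, y, rfl | rfl, hxy⟩
    · exact absurd rfl hxy
    · exact hxy
    · exact hxy.symm
    · exact absurd rfl hxy
  · intro h
    exact ⟨a, Or.inl rfl, b, Or.inr rfl, h⟩

theorem CEdge.exists_eq {n : ℕ} (e : CEdge n) :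
    ∃ a b : Fin n, a ≠ b ∧ (e : Sym2 (Fin n)) = s(a, b) := by
  obtain ⟨e, he⟩ := e
  induction e using Sym2.ind with
  | _ a b => exact ⟨a, b, by simpa using he, rfl⟩

/-- A partial monochromatic matching extends to a perfect matching when the uncovered vertices
satisfy Hall's condition between the two colours. -/
theorem hasPerfectMatching_of_hall {n : ℕ} (c : Fin n → Bool) (Q P : Finset (CEdge n))
    (hQP : Q ⊆ P) (hmono : ∀ e ∈ Q, ¬ Crossing c e)
    (hdisj : ∀ e ∈ Q, ∀ f ∈ Q, ∀ v : Fin n, v ∈ (e : Sym2 (Fin n)) →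
      v ∈ (f : Sym2 (Fin n)) → e = f)
    (hcard : (freeSide c Q true).card = (freeSide c Q false).card)
    (hall : ∀ S ⊆ freeSide c Q true,
      S.card ≤ ((freeSide c Q false).filter (fun b => ∃ a ∈ S, EdgeAdj P a b)).card) :
    hasPerfectMatching n P := by
  set A := freeSide c Q true with hA
  set B := freeSide c Q false with hB
  obtain ⟨f, hfinj, hf⟩ := (Finset.all_card_le_biUnion_card_iff_exists_injective
    (fun a : A => B.filter (fun b => EdgeAdj P a b))).mp (by
      intro s
      have h1 := hall (s.map (Function.Embedding.subtype _)) (by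
        intro x hx
        simp only [Finset.mem_map, Function.Embedding.coe_subtype] at hx
        obtain ⟨y, _, rfl⟩ := hx
        exact y.2)
      rw [Finset.card_map] at h1
      refine h1.trans (Finset.card_le_card ?_)
      intro b hb
      simp only [Finset.mem_filter, Finset.mem_map, Finset.mem_biUnion] at hb ⊢
      obtain ⟨hb, a, ⟨a', ha', rfl⟩, hadj⟩ := hb
      exact ⟨a', ha', hb, hadj⟩)
  have hfB : ∀ a : A, f a ∈ B := fun a => (Finset.mem_filter.mp (hf a)).1
  have hfP : ∀ a : A, EdgeAdj P a (f a) := fun a => (Finset.mem_filter.mp (hf a)).2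
  choose g hgP hg using hfP
  have hsurj : ∀ b ∈ B, ∃ a, f a = b := by
    have h1 : Finset.univ.image f = B := by
      apply Finset.eq_of_subset_of_card_le
      · intro b hb
        obtain ⟨a, _, rfl⟩ := Finset.mem_image.mp hb
        exact hfB a
      · rw [Finset.card_image_of_injective _ hfinj, Finset.card_univ, Fintype.card_coe, hcard]
    intro b hb
    rw [← h1] at hb
    obtain ⟨a, _, rfl⟩ := Finset.mem_image.mp hb
    exact ⟨a, rfl⟩
  have hAf : ∀ a : A, (a : Fin n) ∈ free c Q ∧ c a = true := fun a =>
    Finset.mem_filter.mp a.2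
  have hBf : ∀ b ∈ B, b ∈ free c Q ∧ c b = false := fun b hb => Finset.mem_filter.mp hb
  have hQfree : ∀ e ∈ Q, ∀ v ∈ (e : Sym2 (Fin n)), v ∉ free c Q := by
    intro e he v hv hfree
    exact hmono e he ((Finset.mem_filter.mp hfree).2 e he hv)
  refine ⟨Q ∪ Finset.univ.image g, ?_, ?_⟩
  · apply Finset.union_subset hQP
    intro e he
    obtain ⟨a, _, rfl⟩ := Finset.mem_image.mp he
    exact hgP a
  · have hcover : ∀ a : A, ∀ e, e ∈ Q ∪ Finset.univ.image g →
        ((a : Fin n) ∈ (e : Sym2 (Fin n)) ∨ f a ∈ (e : Sym2 (Fin n))) → e = g a := by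
      intro a e he hae
      rcases Finset.mem_union.mp he with he | he
      · rcases hae with hae | hae
        · exact absurd (hAf a).1 (hQfree e he _ hae)
        · exact absurd (hBf _ (hfB a)).1 (hQfree e he _ hae)
      · obtain ⟨a', _, rfl⟩ := Finset.mem_image.mp he
        have h1 := (hAf a).2
        have h2 := (hAf a').2
        have h3 := (hBf _ (hfB a)).2
        have h4 := (hBf _ (hfB a')).2
        rw [hg a', Sym2.mem_iff, Sym2.mem_iff] at hae
        rcases hae with (hae | hae) | (hae | hae)
        · rw [Subtype.ext hae]
        · rw [hae, h4] at h1; cases h1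
        · rw [hae, h2] at h3; cases h3
        · rw [hfinj hae]
    intro v
    by_cases hv : v ∈ free c Q
    · cases hcv : c v with
      | true =>
        have hvA : v ∈ A := Finset.mem_filter.mpr ⟨hv, hcv⟩
        refine ⟨g ⟨v, hvA⟩, ⟨Finset.mem_union_right _ (Finset.mem_image_of_mem _
          (Finset.mem_univ _)), ?_⟩, ?_⟩
        · rw [hg]; exact Sym2.mem_mk_left _ _
        · rintro e ⟨he, hve⟩
          exact hcover ⟨v, hvA⟩ e he (Or.inl hve)
      | false =>
        have hvB : v ∈ B := Finset.mem_filter.mpr ⟨hv, hcv⟩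
        obtain ⟨a, rfl⟩ := hsurj v hvB
        refine ⟨g a, ⟨Finset.mem_union_right _ (Finset.mem_image_of_mem _
          (Finset.mem_univ _)), ?_⟩, ?_⟩
        · rw [hg]; exact Sym2.mem_mk_right _ _
        · rintro e ⟨he, hve⟩
          exact hcover a e he (Or.inr hve)
    · have hv' := hv
      simp only [free, Finset.mem_filter, Finset.mem_univ, true_and, not_forall] at hv'
      obtain ⟨e, he, hve, _⟩ := hv'
      refine ⟨e, ⟨Finset.mem_union_left _ he, hve⟩, ?_⟩
      rintro e' ⟨he', hve'⟩
      rcases Finset.mem_union.mp he' with he' | he'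
      · exact hdisj _ he' _ he v hve' hve
      · obtain ⟨a, _, rfl⟩ := Finset.mem_image.mp he'
        rw [hg a, Sym2.mem_iff] at hve'
        rcases hve' with rfl | rfl
        · exact absurd (hAf a).1 hv
        · exact absurd (hBf _ (hfB a)).1 hv

/-! ### The strategy and its deterministic properties -/

/-- Before time `T`, greedily purchase disjoint monochromatic edges, keeping at least `k`
uncovered vertices of each colour. Afterwards, purchase an edge joining uncovered vertices of
different colours whenever one of its endpoints has degree less than `K`. -/
noncomputable def pmStrategy {n : ℕ} (c : Fin n → Bool) (k K T : ℕ) : Strategy n :=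
  fun s P e => decide ((∀ v ∈ (e : Sym2 (Fin n)), v ∈ free c P) ∧
    if s < T then ¬ Crossing c e ∧ ∀ v ∈ (e : Sym2 (Fin n)), k < (freeSide c P (c v)).card
    else Crossing c e ∧ ∃ v ∈ (e : Sym2 (Fin n)), cdegree P v < K)

theorem mem_build_succ {n b : ℕ} {S : Strategy n} {ω : EdgeOrdering n} {s : ℕ} {e : CEdge n} :
    e ∈ build n b S ω (s + 1) ↔ e ∈ build n b S ω s ∨
      ∃ h : s < Fintype.card (CEdge n), ω ⟨s, h⟩ = e ∧ S s (build n b S ω s) e = true ∧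
        (build n b S ω s).card < b := by
  simp only [build]
  split_ifs with h h'
  · rw [Finset.mem_insert]
    constructor
    · rintro (rfl | he)
      · exact Or.inr ⟨h, rfl, h'⟩
      · exact Or.inl he
    · rintro (he | ⟨_, rfl, _⟩)
      · exact Or.inr he
      · exact Or.inl rfl
  · constructor
    · exact Or.inl
    · rintro (he | ⟨_, rfl, h2⟩)
      · exact he
      · exact absurd h2 h'
  · constructor
    · exact Or.inl
    · rintro (he | ⟨h2, _⟩)
      · exact he
      · exact absurd h2 h

theorem build_succ_eq {n b : ℕ} (S : Strategy n) (ω : EdgeOrdering n) (s : ℕ) :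
    build n b S ω (s + 1) = build n b S ω s ∨
      ∃ h : s < Fintype.card (CEdge n), S s (build n b S ω s) (ω ⟨s, h⟩) = true ∧
        (build n b S ω s).card < b ∧
        build n b S ω (s + 1) = insert (ω ⟨s, h⟩) (build n b S ω s) := by
  simp only [build]
  split_ifs with h h'
  · exact Or.inr ⟨h, h'.1, h'.2, rfl⟩
  · exact Or.inl rfl
  · exact Or.inl rfl

theorem build_mono {n b : ℕ} {S : Strategy n} {ω : EdgeOrdering n} {s t : ℕ} (h : s ≤ t) :
    build n b S ω s ⊆ build n b S ω t := by
  induction t, h using Nat.le_induction with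
  | base => exact subset_rfl
  | succ t _ ih => exact fun e he => mem_build_succ.mpr (Or.inl (ih he))

theorem free_anti {n : ℕ} {c : Fin n → Bool} {P Q : Finset (CEdge n)} (h : P ⊆ Q) :
    free c Q ⊆ free c P := by
  intro v hv
  simp only [free, Finset.mem_filter, Finset.mem_univ, true_and] at hv ⊢
  exact fun e he => hv e (h he)

theorem freeSide_anti {n : ℕ} {c : Fin n → Bool} {P Q : Finset (CEdge n)} (h : P ⊆ Q)
    (i : Bool) : freeSide c Q i ⊆ freeSide c P i :=
  Finset.filter_subset_filter _ (free_anti h)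

theorem card_free {n : ℕ} (c : Fin n → Bool) (P : Finset (CEdge n)) :
    (free c P).card = (freeSide c P true).card + (freeSide c P false).card := by
  rw [freeSide, freeSide, ← Finset.card_filter_add_card_filter_not (fun v => c v = true)]
  simp

theorem cdegree_mono {n : ℕ} {P Q : Finset (CEdge n)} (h : P ⊆ Q) (v : Fin n) :
    cdegree P v ≤ cdegree Q v :=
  Finset.card_le_card (Finset.filter_subset_filter _ h)

/-- The invariants of the greedy stage. -/
structure GreedyInv {n : ℕ} (c : Fin n → Bool) (k : ℕ) (P : Finset (CEdge n)) : Prop where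
  mono : ∀ e ∈ P, ¬ Crossing c e
  disj : ∀ e ∈ P, ∀ f ∈ P, ∀ v : Fin n, v ∈ (e : Sym2 (Fin n)) →
    v ∈ (f : Sym2 (Fin n)) → e = f
  card : 2 * P.card + (free c P).card = n
  le : ∀ i, k ≤ (freeSide c P i).card
  parity : ∀ i, Even ((freeSide c P i).card + k)

theorem GreedyInv.empty {n m k : ℕ} {c : Fin n → Bool}
    (hc : ∀ i, (Finset.univ.filter (fun v => c v = i)).card = m) (hk : k ≤ m)
    (hpar : Even (m + k)) : GreedyInv c k ∅ where
  mono := by simp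
  disj := by simp
  card := by simp [free]
  le i := by simpa [freeSide, free, hc i] using hk
  parity i := by simpa [freeSide, free, hc i] using hpar

theorem GreedyInv.insert_edge {n k : ℕ} {c : Fin n → Bool} {P : Finset (CEdge n)}
    (hP : GreedyInv c k P) {e : CEdge n} (hfree : ∀ v ∈ (e : Sym2 (Fin n)), v ∈ free c P)
    (hmono : ¬ Crossing c e)
    (hk : ∀ v ∈ (e : Sym2 (Fin n)), k < (freeSide c P (c v)).card) :
    GreedyInv c k (insert e P) := by
  have hnot : ∀ f ∈ P, ∀ v ∈ (e : Sym2 (Fin n)), v ∉ (f : Sym2 (Fin n)) := by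
    intro f hf v hv hvf
    exact hP.mono f hf ((Finset.mem_filter.mp (hfree v hv)).2 f hf hvf)
  obtain ⟨x, y, hxy, he⟩ := e.exists_eq
  have hcxy : c x = c y := by
    by_contra h
    exact hmono ((crossing_iff he).mpr h)
  have hx : x ∈ (e : Sym2 (Fin n)) := by rw [he]; exact Sym2.mem_mk_left _ _
  have hy : y ∈ (e : Sym2 (Fin n)) := by rw [he]; exact Sym2.mem_mk_right _ _
  have heP : e ∉ P := fun h => hnot e h x hx hx
  have hfr : free c (insert e P) = ((free c P).erase x).erase y := by
    ext v
    simp only [free, Finset.mem_filter, Finset.mem_univ, true_and, Finset.mem_insert,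
      forall_eq_or_imp, Finset.mem_erase]
    rw [he, Sym2.mem_iff]
    constructor
    · rintro ⟨h1, h2⟩
      exact ⟨fun h => hmono (h1 (Or.inr h)), fun h => hmono (h1 (Or.inl h)), h2⟩
    · rintro ⟨h1, h2, h3⟩
      exact ⟨fun h => absurd h (by tauto), h3⟩
  have hcardfr : (free c (insert e P)).card + 2 = (free c P).card := by
    rw [hfr]
    have h1 := Finset.card_erase_add_one (hfree x hx)
    have h2 := Finset.card_erase_add_one (Finset.mem_erase.mpr ⟨hxy.symm, hfree y hy⟩)
    omega
  have hside : ∀ i, (freeSide c (insert e P) i).card = (freeSide c P i).card ∨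
      (i = c x ∧ (freeSide c (insert e P) i).card + 2 = (freeSide c P i).card) := by
    intro i
    by_cases hi : i = c x
    · right
      refine ⟨hi, ?_⟩
      have h0 : freeSide c (insert e P) i = ((freeSide c P i).erase x).erase y := by
        unfold freeSide
        rw [hfr]
        ext v
        simp only [Finset.mem_filter, Finset.mem_erase]
        tauto
      have hxs : x ∈ freeSide c P i := Finset.mem_filter.mpr ⟨hfree x hx, hi.symm⟩
      have hys : y ∈ freeSide c P i := Finset.mem_filter.mpr ⟨hfree y hy, by rw [hi, hcxy]⟩
      rw [h0]
      have h1 := Finset.card_erase_add_one hxs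
      have h2 := Finset.card_erase_add_one (Finset.mem_erase.mpr ⟨hxy.symm, hys⟩)
      omega
    · left
      congr 1
      unfold freeSide
      rw [hfr]
      ext v
      simp only [Finset.mem_filter, Finset.mem_erase]
      constructor
      · tauto
      · rintro ⟨h1, h2⟩
        refine ⟨⟨?_, ?_, h1⟩, h2⟩
        · rintro rfl; exact hi (by rw [← h2, hcxy])
        · rintro rfl; exact hi h2.symm
  have hkx := hk x hx
  refine ⟨?_, ?_, ?_, ?_, ?_⟩
  · simp only [Finset.mem_insert, forall_eq_or_imp]
    exact ⟨hmono, hP.mono⟩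
  · intro f hf g hg v hvf hvg
    rcases Finset.mem_insert.mp hf with hf' | hf'
    · rcases Finset.mem_insert.mp hg with hg' | hg'
      · rw [hf', hg']
      · exact absurd hvg (hnot g hg' v (hf' ▸ hvf))
    · rcases Finset.mem_insert.mp hg with hg' | hg'
      · exact absurd hvf (hnot f hf' v (hg' ▸ hvg))
      · exact hP.disj f hf' g hg' v hvf hvg
  · rw [Finset.card_insert_of_notMem heP]
    have := hP.card
    omega
  · intro i
    have h1 := hP.le i
    have h2 := hP.parity i
    rcases hside i with h | ⟨rfl, h⟩
    · omega
    · rw [Nat.even_iff] at h2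
      omega
  · intro i
    have h2 := hP.parity i
    rcases hside i with h | ⟨rfl, h⟩
    · rwa [h]
    · rw [Nat.even_iff] at h2 ⊢
      omega

theorem greedyInv_build {n b m k K T : ℕ} {c : Fin n → Bool}
    (hc : ∀ i, (Finset.univ.filter (fun v => c v = i)).card = m) (hk : k ≤ m)
    (hpar : Even (m + k)) (ω : EdgeOrdering n) {s : ℕ} (hs : s ≤ T) :
    GreedyInv c k (build n b (pmStrategy c k K T) ω s) := by
  induction s with
  | zero => exact GreedyInv.empty hc hk hpar
  | succ s ih =>
    rcases build_succ_eq (b := b) (pmStrategy c k K T) ω s with h | ⟨h, hS, _, heq⟩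
    · rw [h]; exact ih (by omega)
    · rw [heq]
      simp only [pmStrategy, decide_eq_true_eq, if_pos (show s < T by omega)] at hS
      exact (ih (by omega)).insert_edge hS.1 hS.2.1 hS.2.2

/-- If a monochromatic edge seen in the greedy stage has both endpoints uncovered at its end, then
the greedy stage succeeded on the corresponding side. -/
theorem card_freeSide_le_of_seen {n b m k K T : ℕ} {c : Fin n → Bool}
    (hc : ∀ i, (Finset.univ.filter (fun v => c v = i)).card = m) (hk : k ≤ m)
    (hpar : Even (m + k)) (hnb : n ≤ 2 * b) (ω : EdgeOrdering n)
    {q : Fin (Fintype.card (CEdge n))}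
    (hq : (q : ℕ) < T) (hmono : ¬ Crossing c (ω q))
    (hfree : ∀ v ∈ (ω q : Sym2 (Fin n)), v ∈ free c (build n b (pmStrategy c k K T) ω T))
    {v : Fin n} (hv : v ∈ (ω q : Sym2 (Fin n))) :
    (freeSide c (build n b (pmStrategy c k K T) ω T) (c v)).card ≤ k := by
  by_contra! hlt
  set P := build n b (pmStrategy c k K T) ω with hP
  have hsub : P q ⊆ P T := build_mono hq.le
  have hinv : GreedyInv c k (P q) := greedyInv_build hc hk hpar ω hq.le
  obtain ⟨x, y, hxy, he⟩ := (ω q).exists_eq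
  have hcxy : c x = c y := by
    by_contra h
    exact hmono ((crossing_iff he).mpr h)
  have hcolor : ∀ w ∈ (ω q : Sym2 (Fin n)), c w = c v := by
    intro w hw
    by_contra h
    exact hmono ⟨w, hw, v, hv, h⟩
  have hmem : ω q ∈ P (q + 1) := by
    refine mem_build_succ.mpr (Or.inr ⟨q.2, rfl, ?_, ?_⟩)
    · simp only [pmStrategy, decide_eq_true_eq, if_pos hq]
      refine ⟨fun w hw => free_anti hsub (hfree w hw), hmono, fun w hw => ?_⟩
      rw [hcolor w hw]
      exact hlt.trans_le (Finset.card_le_card (freeSide_anti hsub _))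
    · have h1 := hinv.card
      have h2 : 0 < (free c (P q)).card :=
        Finset.card_pos.mpr ⟨v, free_anti hsub (hfree v hv)⟩
      change (P q).card < b
      omega
  have hmem' : ω q ∈ P T := build_mono (show (q : ℕ) + 1 ≤ T by omega) hmem
  exact hmono ((Finset.mem_filter.mp (hfree v hv)).2 _ hmem' hv)

/-- The greedy stage depends only on the monochromatic edges and their positions. -/
theorem build_congr {n b k K T : ℕ} {c : Fin n → Bool} {ω ω' : EdgeOrdering n}
    (h : ∀ q : Fin (Fintype.card (CEdge n)), (q : ℕ) < T →
      ω q = ω' q ∨ (Crossing c (ω q) ∧ Crossing c (ω' q))) {s : ℕ} (hs : s ≤ T) :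
    build n b (pmStrategy c k K T) ω s = build n b (pmStrategy c k K T) ω' s := by
  induction s with
  | zero => rfl
  | succ s ih =>
    have ih := ih (by omega)
    have hrej : ∀ P e, Crossing c e → ¬ (pmStrategy c k K T s P e = true) := by
      intro P e he
      simp only [pmStrategy, decide_eq_true_eq, if_pos (show s < T by omega)]
      tauto
    ext e
    rw [mem_build_succ, mem_build_succ, ih]
    refine or_congr Iff.rfl (exists_congr fun hcard => ?_)
    rcases h ⟨s, hcard⟩ (show s < T by omega) with h | ⟨h1, h2⟩
    · rw [h]
    · constructor
      · rintro ⟨rfl, h3, _⟩; exact absurd h3 (hrej _ _ h1)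
      · rintro ⟨rfl, h3, _⟩; exact absurd h3 (hrej _ _ h2)

theorem mem_build_late {n b k K T : ℕ} {c : Fin n → Bool} {ω : EdgeOrdering n} {s : ℕ}
    (hs : T ≤ s) {e : CEdge n} (he : e ∈ build n b (pmStrategy c k K T) ω s) :
    e ∈ build n b (pmStrategy c k K T) ω T ∨
      (Crossing c e ∧ (∀ v ∈ (e : Sym2 (Fin n)), v ∈ free c (build n b (pmStrategy c k K T) ω T)) ∧
        ∃ q : Fin (Fintype.card (CEdge n)), T ≤ q ∧ (q : ℕ) < s ∧ ω q = e) := by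
  induction s, hs using Nat.le_induction with
  | base => exact Or.inl he
  | succ s hs ih =>
    rcases mem_build_succ.mp he with he | ⟨h, rfl, hS, _⟩
    · rcases ih he with h | ⟨h1, h2, q, h3, h4, h5⟩
      · exact Or.inl h
      · exact Or.inr ⟨h1, h2, q, h3, by omega, h5⟩
    · simp only [pmStrategy, decide_eq_true_eq, if_neg (show ¬ s < T by omega)] at hS
      exact Or.inr ⟨hS.2.1, fun v hv => free_anti (build_mono hs) (hS.1 v hv), ⟨s, h⟩, hs,
        by simp, rfl⟩

theorem free_build_late {n b k K T : ℕ} {c : Fin n → Bool} {ω : EdgeOrdering n} {s : ℕ}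
    (hs : T ≤ s) :
    free c (build n b (pmStrategy c k K T) ω s) = free c (build n b (pmStrategy c k K T) ω T) := by
  apply (free_anti (build_mono hs)).antisymm
  intro v hv
  simp only [free, Finset.mem_filter, Finset.mem_univ, true_and] at hv ⊢
  intro e he hve
  rcases mem_build_late hs he with h | ⟨h, _⟩
  · exact hv e h hve
  · exact h

theorem card_build_late {n b k K T : ℕ} {c : Fin n → Bool} (ω : EdgeOrdering n) {s : ℕ}
    (hs : T ≤ s) :
    (build n b (pmStrategy c k K T) ω s).card ≤ (build n b (pmStrategy c k K T) ω T).card +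
      ∑ v ∈ free c (build n b (pmStrategy c k K T) ω T),
        min (cdegree (build n b (pmStrategy c k K T) ω s) v) K := by
  induction s, hs using Nat.le_induction with
  | base => omega
  | succ s hs ih =>
    rcases build_succ_eq (b := b) (pmStrategy c k K T) ω s with h | ⟨h, hS, _, heq⟩
    · rw [h]; exact ih
    · set P := build n b (pmStrategy c k K T) ω s with hP
      rw [heq]
      by_cases heP : ω ⟨s, h⟩ ∈ P
      · rw [Finset.insert_eq_of_mem heP]; exact ih
      · rw [Finset.card_insert_of_notMem heP]
        simp only [pmStrategy, decide_eq_true_eq, if_neg (show ¬ s < T by omega)] at hS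
        obtain ⟨hfree, _, v, hv, hdeg⟩ := hS
        have hlt : ∑ v ∈ free c (build n b (pmStrategy c k K T) ω T), min (cdegree P v) K
            < ∑ v ∈ free c (build n b (pmStrategy c k K T) ω T),
              min (cdegree (insert (ω ⟨s, h⟩) P) v) K := by
          apply Finset.sum_lt_sum
          · intro w _
            have := cdegree_mono (Finset.subset_insert (ω ⟨s, h⟩) P) w
            omega
          · refine ⟨v, free_anti (build_mono hs) (hfree v hv), ?_⟩
            have h1 : cdegree (insert (ω ⟨s, h⟩) P) v = cdegree P v + 1 := by
              unfold cdegree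
              rw [Finset.filter_insert, if_pos hv, Finset.card_insert_of_notMem]
              exact fun h => heP (Finset.mem_filter.mp h).1
            omega
        omega

/-- A crossing edge between uncovered vertices is purchased if fewer than `K` such edges were seen
before at one of its endpoints. -/
theorem mem_build_of_few_seen {n b m k K T : ℕ} {c : Fin n → Bool}
    (hc : ∀ i, (Finset.univ.filter (fun v => c v = i)).card = m) (hk : k ≤ m)
    (hpar : Even (m + k)) (ω : EdgeOrdering n)
    (hcard : ∀ i, (freeSide c (build n b (pmStrategy c k K T) ω T) i).card = k)
    (hbud : n + 4 * k * K ≤ 2 * b)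
    {q : Fin (Fintype.card (CEdge n))} (hq : T ≤ (q : ℕ)) (hcross : Crossing c (ω q))
    (hfree : ∀ v ∈ (ω q : Sym2 (Fin n)), v ∈ free c (build n b (pmStrategy c k K T) ω T))
    {v : Fin n} (hv : v ∈ (ω q : Sym2 (Fin n)))
    (hfew : (Finset.univ.filter (fun p : Fin (Fintype.card (CEdge n)) => T ≤ (p : ℕ) ∧ p < q ∧
      Crossing c (ω p) ∧ v ∈ (ω p : Sym2 (Fin n)) ∧
      ∀ w ∈ (ω p : Sym2 (Fin n)), w ∈ free c (build n b (pmStrategy c k K T) ω T))).card < K)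
    {t : ℕ} (ht : (q : ℕ) < t) :
    ω q ∈ build n b (pmStrategy c k K T) ω t := by
  set P := build n b (pmStrategy c k K T) ω with hP
  have hinv : GreedyInv c k (P T) := greedyInv_build hc hk hpar ω le_rfl
  have hdeg : cdegree (P q) v < K := by
    refine lt_of_le_of_lt ?_ hfew
    unfold cdegree
    apply Finset.card_le_card_of_injOn ω.symm
    · intro e he
      simp only [Finset.coe_filter, Set.mem_ofPred_eq, Finset.mem_univ, true_and] at he ⊢
      rcases mem_build_late hq he.1 with h | ⟨h1, h2, p, h3, h4, rfl⟩
      · exact absurd ((Finset.mem_filter.mp (hfree v hv)).2 e h he.2) (hinv.mono e h)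
      · rw [Equiv.symm_apply_apply]
        exact ⟨h3, h4, h1, he.2, h2⟩
    · exact ω.symm.injective.injOn
  refine build_mono (show (q : ℕ) + 1 ≤ t from ht)
    (mem_build_succ.mpr (Or.inr ⟨q.2, rfl, ?_, ?_⟩))
  · simp only [pmStrategy, decide_eq_true_eq, if_neg (show ¬ (q : ℕ) < T by omega)]
    refine ⟨?_, hcross, v, hv, hdeg⟩
    intro w hw
    rw [free_build_late hq]
    exact hfree w hw
  · have h1 := card_build_late (b := b) (k := k) (K := K) (c := c) ω hq
    have h2 : ∑ w ∈ free c (P T), min (cdegree (P q) w) K < ∑ w ∈ free c (P T), K :=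
      Finset.sum_lt_sum (fun w _ => min_le_right _ _) ⟨v, hfree v hv, by omega⟩
    rw [Finset.sum_const, smul_eq_mul, card_free, hcard, hcard] at h2
    have h3 := hinv.card
    change (P q).card < b
    change (P q).card ≤ (P T).card + ∑ w ∈ free c (P T), min (cdegree (P q) w) K at h1
    have : (k + k) * K * 2 = 4 * k * K := by ring
    omega

/-! ### Probability estimates for the greedy stage -/

theorem card_filter_lt_fin {N T : ℕ} (h : T ≤ N) :
    (Finset.univ.filter (fun q : Fin N => (q : ℕ) < T)).card = T := by
  rw [Fin.card_filter_val_lt, min_eq_right h]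

theorem card_star_le {n : ℕ} (v : Fin n) :
    (Finset.univ.filter (fun e : CEdge n => v ∈ (e : Sym2 (Fin n)))).card ≤ n := by
  have h : (Finset.univ.filter (fun e : CEdge n => v ∈ (e : Sym2 (Fin n)))).card ≤
      ((Finset.univ : Finset (Fin n)).image (fun w => s(v, w))).card := by
    apply Finset.card_le_card_of_injOn (fun e : CEdge n => (e : Sym2 (Fin n)))
    · intro e he
      have he : v ∈ (e : Sym2 (Fin n)) := by simpa using he
      obtain ⟨w, hw⟩ := he
      simp only [Finset.coe_image, Set.mem_image]
      exact ⟨w, by simp, hw.symm⟩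
    · exact Subtype.val_injective.injOn
  refine h.trans (Finset.card_image_le.trans ?_)
  simp

theorem choose_two_le_card_inside {n k : ℕ} (W : Finset (Fin n)) (hW : k ≤ W.card) :
    k.choose 2 ≤
      (Finset.univ.filter (fun e : CEdge n => ∀ v ∈ (e : Sym2 (Fin n)), v ∈ W)).card := by
  refine (Nat.choose_le_choose 2 hW).trans ?_
  rw [← Sym2.card_image_offDiag]
  have h : W.offDiag.image (Function.uncurry Sym2.mk) ⊆
      (Finset.univ.filter (fun e : CEdge n => ∀ v ∈ (e : Sym2 (Fin n)), v ∈ W)).image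
        (fun e : CEdge n => (e : Sym2 (Fin n))) := by
    intro e he
    obtain ⟨⟨a, b⟩, hab, rfl⟩ := Finset.mem_image.mp he
    rw [Finset.mem_offDiag] at hab
    refine Finset.mem_image.mpr ⟨⟨s(a, b), by simpa using hab.2.2⟩, ?_, rfl⟩
    simp only [Finset.mem_filter, Finset.mem_univ, true_and, Sym2.mem_iff]
    rintro v (rfl | rfl)
    · exact hab.1
    · exact hab.2.1
  exact (Finset.card_le_card h).trans Finset.card_image_le

theorem card_div_le_one_sub {α : Type} [Fintype α] (t : Finset α) (j : ℕ)
    (h : j ≤ (Finset.univ.filter (fun x => x ∉ t)).card) (N : ℕ) (hN : Fintype.card α ≤ N) :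
    (t.card : ℝ) / Fintype.card α ≤ 1 - (j : ℝ) / N := by
  have h1 : t.card + (Finset.univ.filter (fun x => x ∉ t)).card = Fintype.card α := by
    rw [← Finset.card_univ,
      ← Finset.card_filter_add_card_filter_not (s := Finset.univ) (fun x => x ∈ t)]
    simp
  have h2 : (t.card : ℝ) + j ≤ Fintype.card α := by exact_mod_cast (by omega)
  rcases Nat.eq_zero_or_pos (Fintype.card α) with h0 | h0
  · have : j = 0 := by omega
    simp [h0, this]
  · have h0' : (0 : ℝ) < Fintype.card α := by exact_mod_cast h0
    have h3 : (j : ℝ) / N ≤ j / Fintype.card α := by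
      apply div_le_div_of_nonneg_left (by positivity) h0'
      exact_mod_cast hN
    have h4 : (t.card : ℝ) / Fintype.card α + j / Fintype.card α ≤ 1 := by
      rw [← add_div, div_le_one h0']
      exact h2
    linarith

theorem uprob_greedy_fails_le {n b m k K T : ℕ} {c : Fin n → Bool}
    (hc : ∀ i, (Finset.univ.filter (fun v => c v = i)).card = m) (hk : k ≤ m)
    (hpar : Even (m + k)) (hnb : n ≤ 2 * b) (hT : T ≤ Fintype.card (CEdge n))
    (hkN : (k + 1).choose 2 ≤ Fintype.card (CEdge n)) :
    uprob (fun ω : EdgeOrdering n =>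
      ∃ i, (freeSide c (build n b (pmStrategy c k K T) ω T) i).card ≠ k) ≤
      2 ^ n * (1 - ((k + 1).choose 2 : ℝ) / Fintype.card (CEdge n)) ^ T := by
  set J : Finset (Finset (Fin n)) := Finset.univ.filter (fun W => k + 1 ≤ W.card) with hJ
  set x : ℝ := (1 - ((k + 1).choose 2 : ℝ) / Fintype.card (CEdge n)) ^ T with hx
  have h1 : ∀ W ∈ J, uprob (fun ω : EdgeOrdering n =>
      ∀ q ∈ Finset.univ.filter (fun q : Fin (Fintype.card (CEdge n)) => (q : ℕ) < T),
        ω q ∈ Finset.univ.filter (fun e : CEdge n => ¬ ∀ v ∈ (e : Sym2 (Fin n)), v ∈ W)) ≤ x := by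
    intro W hW
    refine (uprob_mapsTo_le (by simp) _ _).trans ?_
    rw [card_filter_lt_fin hT, hx]
    apply pow_le_pow_left₀ (by positivity)
    apply card_div_le_one_sub _ _ _ _ le_rfl
    refine (choose_two_le_card_inside W (Finset.mem_filter.mp hW).2).trans (le_of_eq ?_)
    congr 1
    ext e
    simp
  have h2 := uprob_exists_le J _ x h1
  have hx0 : 0 ≤ x := by
    apply pow_nonneg
    have : ((k + 1).choose 2 : ℝ) / Fintype.card (CEdge n) ≤ 1 :=
      div_le_one_of_le₀ (by exact_mod_cast hkN) (by positivity)
    linarith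
  have h3 : (J.card : ℝ) ≤ 2 ^ n := by
    have : J.card ≤ 2 ^ n := by
      refine (Finset.card_le_univ J).trans ?_
      simp
    exact_mod_cast this
  refine (uprob_mono ?_).trans (h2.trans (mul_le_mul_of_nonneg_right h3 hx0))
  rintro ω ⟨i, hi⟩
  have hinv : GreedyInv c k (build n b (pmStrategy c k K T) ω T) :=
    greedyInv_build hc hk hpar ω le_rfl
  have hlt := lt_of_le_of_ne (hinv.le i) (Ne.symm hi)
  refine ⟨freeSide c (build n b (pmStrategy c k K T) ω T) i, by simp [hJ]; omega, ?_⟩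
  intro q hq
  simp only [Finset.mem_filter, Finset.mem_univ, true_and] at hq ⊢
  intro hin
  obtain ⟨a, _, _, he⟩ := (ω q).exists_eq
  have ha : a ∈ (ω q : Sym2 (Fin n)) := by rw [he]; exact Sym2.mem_mk_left _ _
  have hcol : ∀ v ∈ (ω q : Sym2 (Fin n)), c v = i := fun v hv =>
    (Finset.mem_filter.mp (hin v hv)).2
  have := card_freeSide_le_of_seen hc hk hpar hnb ω hq
    (by rintro ⟨x, hx, y, hy, hxy⟩; exact hxy ((hcol x hx).trans (hcol y hy).symm))
    (fun v hv => (Finset.mem_filter.mp (hin v hv)).1) ha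
  rw [hcol a ha] at this
  omega

theorem uprob_large_degree_le {n T : ℕ} (h : ℕ) (hT : T ≤ Fintype.card (CEdge n)) :
    uprob (fun ω : EdgeOrdering n => ∃ v : Fin n, h ≤ (Finset.univ.filter
      (fun q : Fin (Fintype.card (CEdge n)) => (q : ℕ) < T ∧ v ∈ (ω q : Sym2 (Fin n)))).card) ≤
      n * (2 ^ T * ((n : ℝ) / Fintype.card (CEdge n)) ^ h) := by
  have h1 : ∀ v ∈ (Finset.univ : Finset (Fin n)), uprob (fun ω : EdgeOrdering n => ∃ Q ∈
      Finset.powersetCard h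
        (Finset.univ.filter (fun q : Fin (Fintype.card (CEdge n)) => (q : ℕ) < T)),
        ∀ q ∈ Q, ω q ∈ Finset.univ.filter (fun e : CEdge n => v ∈ (e : Sym2 (Fin n)))) ≤
      2 ^ T * ((n : ℝ) / Fintype.card (CEdge n)) ^ h := by
    intro v _
    refine (uprob_exists_le _ _ (((n : ℝ) / Fintype.card (CEdge n)) ^ h) ?_).trans ?_
    · intro Q hQ
      refine (uprob_mapsTo_le (by simp) _ _).trans ?_
      rw [(Finset.mem_powersetCard.mp hQ).2]
      apply pow_le_pow_left₀ (by positivity)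
      apply div_le_div_of_nonneg_right _ (by positivity)
      exact_mod_cast card_star_le v
    · apply mul_le_mul_of_nonneg_right _ (by positivity)
      rw [Finset.card_powersetCard, card_filter_lt_fin hT]
      exact_mod_cast Nat.choose_le_two_pow T h
  have h2 := uprob_exists_le _ _ _ h1
  rw [Finset.card_univ, Fintype.card_fin] at h2
  refine (uprob_mono ?_).trans h2
  rintro ω ⟨v, hv⟩
  obtain ⟨Q, hQ, hQc⟩ := Finset.exists_subset_card_eq hv
  refine ⟨v, Finset.mem_univ _, Q, ?_, ?_⟩
  · refine Finset.mem_powersetCard.mpr ⟨fun q hq => ?_, hQc⟩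
    simpa using ((Finset.mem_filter.mp (hQ hq)).2).1
  · intro q hq
    simpa using ((Finset.mem_filter.mp (hQ hq)).2).2

/-- The edge `e` joins `v` to a vertex of `W`. -/
def JoinsTo {n : ℕ} (v : Fin n) (W : Finset (Fin n)) (e : CEdge n) : Prop :=
  ∃ w ∈ W, (e : Sym2 (Fin n)) = s(v, w)

theorem le_card_joinsTo {n : ℕ} (v : Fin n) (W : Finset (Fin n)) (hv : v ∉ W) :
    W.card ≤ (Finset.univ.filter (fun e : CEdge n => JoinsTo v W e)).card := by
  have h : W.image (fun w => s(v, w)) ⊆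
      (Finset.univ.filter (fun e : CEdge n => JoinsTo v W e)).image Subtype.val := by
    intro e he
    obtain ⟨w, hw, rfl⟩ := Finset.mem_image.mp he
    refine Finset.mem_image.mpr ⟨⟨s(v, w), ?_⟩, ?_, rfl⟩
    · rw [Sym2.mk_isDiag_iff]; rintro rfl; exact hv hw
    · simp only [Finset.mem_filter, Finset.mem_univ, true_and]
      exact ⟨w, hw, rfl⟩
  have h2 : (W.image (fun w => s(v, w))).card = W.card := by
    apply Finset.card_image_of_injective
    intro a b hab
    exact Sym2.congr_right.mp hab
  rw [← h2]
  exact (Finset.card_le_card h).trans Finset.card_image_le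

theorem uprob_perm_le {α : Type} [Fintype α] [inst : Fintype (Equiv.Perm α)]
    (E : Equiv.Perm α → Prop) (s t : Finset α) (j N : ℕ) (hE : ∀ g, E g → ∀ x ∈ s, g x ∈ t)
    (hj : j ≤ (Finset.univ.filter (fun x => x ∉ t)).card) (hN : Fintype.card α ≤ N) :
    @uprob _ inst E ≤ (1 - (j : ℝ) / N) ^ s.card := by
  refine (uprob_mono hE).trans ((uprob_mapsTo_le rfl s t).trans ?_)
  exact pow_le_pow_left₀ (by positivity) (card_div_le_one_sub _ _ hj _ hN) _

/-- A fixed window after the greedy stage is unlikely to miss all the edges from an uncovered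
vertex to the uncovered vertices of the other colour. -/
theorem uprob_window_misses_le {n b k K T : ℕ} {c : Fin n → Bool} (h : ℕ) (v : Fin n)
    (I : Finset (Fin (Fintype.card (CEdge n)))) (hI : ∀ q ∈ I, T ≤ (q : ℕ))
    (hkN : k ≤ Fintype.card (CEdge n)) :
    uprob (fun ω : EdgeOrdering n =>
      (freeSide c (build n b (pmStrategy c k K T) ω T) (!c v)).card = k ∧
      (Finset.univ.filter (fun q : Fin (Fintype.card (CEdge n)) =>
        (q : ℕ) < T ∧ v ∈ (ω q : Sym2 (Fin n)))).card < h ∧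
      ∀ q ∈ I, ¬ JoinsTo v (freeSide c (build n b (pmStrategy c k K T) ω T) (!c v)) (ω q)) ≤
      (1 - ((k - h : ℕ) : ℝ) / Fintype.card (CEdge n)) ^ I.card := by
  set F : EdgeOrdering n → Finset (Fin n) := fun ω =>
    freeSide c (build n b (pmStrategy c k K T) ω T) (!c v) with hF
  set D : EdgeOrdering n → ℕ := fun ω =>
    (Finset.univ.filter (fun q : Fin (Fintype.card (CEdge n)) =>
        (q : ℕ) < T ∧ v ∈ (ω q : Sym2 (Fin n)))).card with hD
  set x : ℝ := (1 - ((k - h : ℕ) : ℝ) / Fintype.card (CEdge n)) ^ I.card with hx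
  let act : Equiv.Perm {q : Fin (Fintype.card (CEdge n)) // T ≤ (q : ℕ)} →
      EdgeOrdering n → EdgeOrdering n :=
    fun g ω => (Equiv.Perm.ofSubtype g).trans ω
  have hpre : ∀ g ω (q : Fin (Fintype.card (CEdge n))), (q : ℕ) < T → act g ω q = ω q := by
    intro g ω q hq
    simp only [act, Equiv.trans_apply]
    rw [Equiv.Perm.ofSubtype_apply_of_not_mem]
    omega
  have hFact : ∀ g ω, F (act g ω) = F ω := by
    intro g ω
    simp only [hF]
    rw [build_congr (fun q hq => Or.inl (hpre g ω q hq)) le_rfl]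
  have hDact : ∀ g ω, D (act g ω) = D ω := by
    intro g ω
    simp only [hD]
    congr 1
    ext q
    simp only [Finset.mem_filter, Finset.mem_univ, true_and]
    refine and_congr_right fun hq => ?_
    rw [hpre g ω q hq]
  have hinj : ∀ g, Function.Injective (act g) := by
    intro g ω ω' hω
    ext q : 1
    have := congrArg (fun f : EdgeOrdering n => f ((Equiv.Perm.ofSubtype g).symm q)) hω
    simpa [act] using this
  have main : ∀ ω, ((F ω).card = k ∧ D ω < h) →
      uprob (fun g : Equiv.Perm {q : Fin (Fintype.card (CEdge n)) // T ≤ (q : ℕ)} =>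
        (F (act g ω)).card = k ∧ D (act g ω) < h ∧ ∀ q ∈ I, ¬ JoinsTo v (F (act g ω)) (act g ω q))
        ≤ x := by
    rintro ω ⟨hk, hd⟩
    set t : Finset {q : Fin (Fintype.card (CEdge n)) // T ≤ (q : ℕ)} :=
      Finset.univ.filter (fun q => ¬ JoinsTo v (F ω) (ω q)) with ht
    set I' : Finset {q : Fin (Fintype.card (CEdge n)) // T ≤ (q : ℕ)} := I.subtype _ with hI'
    have hI'c : I'.card = I.card := by
      rw [hI', Finset.card_subtype, Finset.filter_true_of_mem hI]
    rw [hx, ← hI'c]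
    apply uprob_perm_le _ I' t
    · rintro g ⟨_, _, hg⟩ q hq
      have := hg q (by simpa [hI'] using hq)
      rw [hFact] at this
      simp only [act, Equiv.trans_apply, Equiv.Perm.ofSubtype_apply_coe] at this
      simpa [ht] using this
    · have hvF : v ∉ F ω := by
        intro hv
        have := (Finset.mem_filter.mp hv).2
        simp at this
      have h1 := le_card_joinsTo v (F ω) hvF
      have h2 : (Finset.univ.filter (fun e : CEdge n => JoinsTo v (F ω) e)).card ≤
          D ω + (Finset.univ.filter (fun q => q ∉ t)).card := by
        have h3 : Finset.univ.filter (fun e : CEdge n => JoinsTo v (F ω) e) ⊆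
            (Finset.univ.filter (fun q : Fin (Fintype.card (CEdge n)) =>
              (q : ℕ) < T ∧ v ∈ (ω q : Sym2 (Fin n)))).image ω ∪
            (Finset.univ.filter (fun q => q ∉ t)).image
              (fun q : {q : Fin (Fintype.card (CEdge n)) // T ≤ (q : ℕ)} => ω q) := by
          intro e he
          have he : JoinsTo v (F ω) e := by simpa using he
          rw [Finset.mem_union]
          by_cases hq : ((ω.symm e : Fin (Fintype.card (CEdge n))) : ℕ) < T
          · left
            refine Finset.mem_image.mpr ⟨ω.symm e, ?_, by simp⟩
            simp only [Finset.mem_filter, Finset.mem_univ, true_and, Equiv.apply_symm_apply]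
            refine ⟨hq, ?_⟩
            obtain ⟨w, _, hw⟩ := he
            rw [hw]; exact Sym2.mem_mk_left _ _
          · right
            refine Finset.mem_image.mpr ⟨⟨ω.symm e, not_lt.mp hq⟩, ?_, by simp⟩
            simp [ht, he]
        refine (Finset.card_le_card h3).trans ((Finset.card_union_le _ _).trans ?_)
        exact add_le_add Finset.card_image_le Finset.card_image_le
      have h4 : k - h ≤ (Finset.univ.filter (fun q => q ∉ t)).card := by omega
      convert h4
    · refine (Fintype.card_subtype_le _).trans ?_
      simp
  have hx0 : 0 ≤ x := by
    apply pow_nonneg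
    have : ((k - h : ℕ) : ℝ) / Fintype.card (CEdge n) ≤ 1 :=
      div_le_one_of_le₀ (by exact_mod_cast (by omega)) (by positivity)
    linarith
  have hfin := uprob_le_of_average act hinj
    (fun ω => (F ω).card = k ∧ D ω < h ∧ ∀ q ∈ I, ¬ JoinsTo v (F ω) (ω q))
    (fun ω => (F ω).card = k ∧ D ω < h)
    (fun g ω hE => ⟨by rw [← hFact g ω]; exact hE.1, by rw [← hDact g ω]; exact hE.2.1⟩) x main
  exact hfin.trans (mul_le_of_le_one_right hx0 (uprob_le_one _))

/-! ### Shuffling the crossing edges -/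

theorem exists_initial_subset {α : Type} [LinearOrder α] (Q : Finset α) (K : ℕ)
    (h : K ≤ Q.card) :
    ∃ R ⊆ Q, R.card = K ∧ ∀ q ∈ R, (Q.filter (fun p => p < q)).card < K := by
  have key : ∃ R ⊆ Q, R.card = K ∧ ∀ q ∈ R, ∀ p ∈ Q, p < q → p ∈ R := by
    induction K with
    | zero => exact ⟨∅, by simp⟩
    | succ K ih =>
      obtain ⟨R, hR, hc, hi⟩ := ih (by omega)
      have hne : (Q \ R).Nonempty := by
        rw [← Finset.card_pos, Finset.card_sdiff_of_subset hR]
        omega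
      set x := (Q \ R).min' hne with hx
      have hxm : x ∈ Q \ R := Finset.min'_mem _ _
      rw [Finset.mem_sdiff] at hxm
      refine ⟨insert x R, Finset.insert_subset hxm.1 hR, ?_, ?_⟩
      · rw [Finset.card_insert_of_notMem hxm.2, hc]
      · intro q hq p hp hpq
        rw [Finset.mem_insert] at hq ⊢
        rcases hq with rfl | hq
        · by_contra hcon
          push Not at hcon
          exact absurd (Finset.min'_le _ p (Finset.mem_sdiff.mpr ⟨hp, hcon.2⟩)) (not_le.mpr hpq)
        · exact Or.inr (hi q hq p hp hpq)
  obtain ⟨R, hR, hc, hi⟩ := key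
  refine ⟨R, hR, hc, fun q hq => ?_⟩
  rw [← hc]
  apply Finset.card_lt_card
  refine ⟨fun p hp => ?_, fun hs => ?_⟩
  · exact hi q hq p (Finset.mem_filter.mp hp).1 (Finset.mem_filter.mp hp).2
  · exact lt_irrefl q (Finset.mem_filter.mp (hs hq)).2

/-- Permuting the second endpoints of the edges between two disjoint vertex sets. -/
theorem exists_shuffle {n : ℕ} (A B : Finset (Fin n)) (hAB : Disjoint A B) :
    ∃ π : ({x // x ∈ A} → Equiv.Perm {x // x ∈ B}) → Equiv.Perm (CEdge n),
      (∀ g (e : CEdge n) (a : {x // x ∈ A}) (b : {x // x ∈ B}),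
        (e : Sym2 (Fin n)) = s((a : Fin n), (b : Fin n)) →
        (π g e : Sym2 (Fin n)) = s((a : Fin n), (g a b : Fin n))) ∧
      (∀ g (e : CEdge n), (¬ ∃ (a : {x // x ∈ A}) (b : {x // x ∈ B}),
        (e : Sym2 (Fin n)) = s((a : Fin n), (b : Fin n))) → π g e = e) := by
  have hne : ∀ (a : {x // x ∈ A}) (b : {x // x ∈ B}), (a : Fin n) ≠ b := fun a b h =>
    Finset.disjoint_left.mp hAB a.2 (h ▸ b.2)
  let ι : {x // x ∈ A} × {x // x ∈ B} → CEdge n := fun p =>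
    ⟨s((p.1 : Fin n), (p.2 : Fin n)), by rw [Sym2.mk_isDiag_iff]; exact hne _ _⟩
  have hι : Function.Injective ι := by
    rintro ⟨a, b⟩ ⟨a', b'⟩ h
    have h := congrArg Subtype.val h
    simp only [ι] at h
    rcases Sym2.eq_iff.mp h with ⟨h1, h2⟩ | ⟨h1, _⟩
    · rw [Subtype.ext h1, Subtype.ext h2]
    · exact absurd h1 (hne a b')
  refine ⟨fun g => Equiv.Perm.extendDomain (Equiv.prodShear (Equiv.refl _) g)
    (Equiv.ofInjective ι hι), ?_, ?_⟩
  · intro g e a b he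
    have : e = (Equiv.ofInjective ι hι (a, b) : CEdge n) := Subtype.ext he
    rw [this, Equiv.Perm.extendDomain_apply_image]
    rfl
  · intro g e he
    apply Equiv.Perm.extendDomain_apply_not_subtype
    rintro ⟨⟨a, b⟩, h⟩
    exact he ⟨a, b, h ▸ rfl⟩

theorem uprob_hall_violation_le {n b m k K T τ : ℕ} {c : Fin n → Bool}
    (hc : ∀ i, (Finset.univ.filter (fun v => c v = i)).card = m) (hk : k ≤ m)
    (hpar : Even (m + k)) (hbud : n + 4 * k * K ≤ 2 * b)
    (U : Finset (Fin n)) (hU : ∀ j, (U.filter (fun v => c v = j)).card = k) (i : Bool)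
    (S R : Finset (Fin n)) (hS : S ⊆ U.filter (fun v => c v = i))
    (hR : R ⊆ U.filter (fun v => c v = !i)) :
    uprob (fun ω : EdgeOrdering n =>
      free c (build n b (pmStrategy c k K T) ω T) = U ∧
      (∀ a ∈ S, K ≤ (Finset.univ.filter (fun q : Fin (Fintype.card (CEdge n)) =>
        T ≤ (q : ℕ) ∧ (q : ℕ) < τ ∧
          JoinsTo a (U.filter (fun v => c v = !i)) (ω q))).card) ∧
      ∀ a ∈ S, ∀ w ∈ U.filter (fun v => c v = !i) \ R,
        ¬ EdgeAdj (build n b (pmStrategy c k K T) ω τ) a w) ≤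
      ((R.card : ℝ) / k) ^ (K * S.card) * uprob (fun ω : EdgeOrdering n =>
        free c (build n b (pmStrategy c k K T) ω T) = U) := by
  set A := U.filter (fun v => c v = i) with hA
  set B := U.filter (fun v => c v = !i) with hB
  have hcA : ∀ a ∈ A, c a = i := fun a ha => (Finset.mem_filter.mp ha).2
  have hcB : ∀ a ∈ B, c a = !i := fun a ha => (Finset.mem_filter.mp ha).2
  have hAB : Disjoint A B := by
    rw [Finset.disjoint_left]
    intro a ha hb
    have := (hcA a ha).symm.trans (hcB a hb)
    simp at this
  obtain ⟨π, hπ, hπ'⟩ := exists_shuffle A B hAB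
  have hne : ∀ a ∈ A, ∀ w ∈ B, a ≠ w := fun a ha w hw h =>
    Finset.disjoint_left.mp hAB ha (h ▸ hw)
  have hjoin : ∀ g e, ∀ a ∈ A, JoinsTo a B (π g e) ↔ JoinsTo a B e := by
    intro g e a ha
    by_cases he : ∃ (a : {x // x ∈ A}) (b : {x // x ∈ B}),
        (e : Sym2 (Fin n)) = s((a : Fin n), (b : Fin n))
    · obtain ⟨a', w', he⟩ := he
      have hpe := hπ g e a' w' he
      constructor
      · rintro ⟨w, hw, h⟩
        rw [hpe] at h
        rcases Sym2.eq_iff.mp h with ⟨h1, _⟩ | ⟨h1, _⟩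
        · exact ⟨w', w'.2, by rw [he, h1]⟩
        · exact absurd h1 (hne _ a'.2 _ hw)
      · rintro ⟨w, hw, h⟩
        rw [he] at h
        rcases Sym2.eq_iff.mp h with ⟨h1, _⟩ | ⟨h1, _⟩
        · exact ⟨g a' w', (g a' w').2, by rw [hpe, h1]⟩
        · exact absurd h1 (hne _ a'.2 _ hw)
    · rw [hπ' g e he]
  have hcross : ∀ g e, π g e = e ∨ (Crossing c (π g e) ∧ Crossing c e) := by
    intro g e
    by_cases he : ∃ (a : {x // x ∈ A}) (b : {x // x ∈ B}),
        (e : Sym2 (Fin n)) = s((a : Fin n), (b : Fin n))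
    · obtain ⟨a', w', he⟩ := he
      refine Or.inr ⟨(crossing_iff (hπ g e a' w' he)).mpr ?_, (crossing_iff he).mpr ?_⟩
      · rw [hcA _ a'.2, hcB _ (g a' w').2]; simp
      · rw [hcA _ a'.2, hcB _ w'.2]; simp
    · exact Or.inl (hπ' g e he)
  let act : ({x // x ∈ A} → Equiv.Perm {x // x ∈ B}) → EdgeOrdering n → EdgeOrdering n :=
    fun g ω => ω.trans (π g)
  have hact : ∀ g ω q, act g ω q = π g (ω q) := fun g ω q => rfl
  have hinj : ∀ g, Function.Injective (act g) := by
    intro g ω ω' hω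
    ext q : 1
    have := congrArg (fun f : EdgeOrdering n => f q) hω
    simpa [hact] using this
  have hbuild : ∀ g ω, build n b (pmStrategy c k K T) (act g ω) T =
      build n b (pmStrategy c k K T) ω T := fun g ω =>
    build_congr (fun q _ => hcross g (ω q)) le_rfl
  have main : ∀ ω, (free c (build n b (pmStrategy c k K T) ω T) = U ∧
      ∀ a ∈ S, K ≤ (Finset.univ.filter (fun q : Fin (Fintype.card (CEdge n)) =>
        T ≤ (q : ℕ) ∧ (q : ℕ) < τ ∧ JoinsTo a B (ω q))).card) →
      uprob (fun g => free c (build n b (pmStrategy c k K T) (act g ω) T) = U ∧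
      (∀ a ∈ S, K ≤ (Finset.univ.filter (fun q : Fin (Fintype.card (CEdge n)) =>
        T ≤ (q : ℕ) ∧ (q : ℕ) < τ ∧ JoinsTo a B (act g ω q))).card) ∧
      ∀ a ∈ S, ∀ w ∈ B \ R, ¬ EdgeAdj (build n b (pmStrategy c k K T) (act g ω) τ) a w) ≤
      ((R.card : ℝ) / k) ^ (K * S.card) := by
    rintro ω ⟨hf, hK⟩
    have hch : ∀ a ∈ S, ∃ β : Finset {x // x ∈ B}, β.card = K ∧ ∀ x ∈ β,
        ∃ q : Fin (Fintype.card (CEdge n)), T ≤ (q : ℕ) ∧ (q : ℕ) < τ ∧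
          (ω q : Sym2 (Fin n)) = s(a, (x : Fin n)) ∧
          ((Finset.univ.filter (fun q : Fin (Fintype.card (CEdge n)) =>
            T ≤ (q : ℕ) ∧ (q : ℕ) < τ ∧ JoinsTo a B (ω q))).filter (fun p => p < q)).card < K := by
      intro a ha
      obtain ⟨Q, hQ, hQc, hQf⟩ := exists_initial_subset _ K (hK a ha)
      have hw : ∀ q ∈ Q, ∃ w : {x // x ∈ B}, (ω q : Sym2 (Fin n)) = s(a, (w : Fin n)) := by
        intro q hq
        obtain ⟨w, hw, h⟩ := (Finset.mem_filter.mp (hQ hq)).2.2.2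
        exact ⟨⟨w, hw⟩, h⟩
      choose f hf using fun q : {q // q ∈ Q} => hw q q.2
      refine ⟨Finset.univ.image f, ?_, ?_⟩
      · rw [Finset.card_image_of_injective, Finset.card_univ, Fintype.card_coe, hQc]
        intro p q hpq
        have h : ω p = ω q := Subtype.ext (by rw [hf p, hf q, hpq])
        exact Subtype.ext (ω.injective h)
      · intro x hx
        obtain ⟨q, _, rfl⟩ := Finset.mem_image.mp hx
        have h := (Finset.mem_filter.mp (hQ q.2)).2
        refine ⟨q, h.1, h.2.1, hf q, ?_⟩
        convert hQf q q.2
    have hch' : ∀ a : {x // x ∈ A}, ∃ β : Finset {x // x ∈ B},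
        (a : Fin n) ∈ S → β.card = K ∧ ∀ x ∈ β,
        ∃ q : Fin (Fintype.card (CEdge n)), T ≤ (q : ℕ) ∧ (q : ℕ) < τ ∧
          (ω q : Sym2 (Fin n)) = s((a : Fin n), (x : Fin n)) ∧
          ((Finset.univ.filter (fun q : Fin (Fintype.card (CEdge n)) =>
            T ≤ (q : ℕ) ∧ (q : ℕ) < τ ∧ JoinsTo (a : Fin n) B (ω q))).filter
              (fun p => p < q)).card < K := by
      intro a
      by_cases ha : (a : Fin n) ∈ S
      · obtain ⟨β, h⟩ := hch a ha
        exact ⟨β, fun _ => h⟩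
      · exact ⟨∅, fun h => absurd h ha⟩
    choose β hβ using hch'
    have hcardS : (S.subtype (fun x => x ∈ A)).card = S.card := by
      rw [Finset.card_subtype, Finset.filter_true_of_mem (fun x hx => hS hx)]
    have hcardR : (R.subtype (fun x => x ∈ B)).card = R.card := by
      rw [Finset.card_subtype, Finset.filter_true_of_mem (fun x hx => hR hx)]
    have hcardB : Fintype.card {x // x ∈ B} = k := by
      rw [Fintype.card_coe]; exact hU _
    have hpi := uprob_pi_mapsTo_le (S.subtype (fun x => x ∈ A)) β K
      (fun a ha => (hβ a (by simpa using ha)).1) (R.subtype (fun x => x ∈ B))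
    rw [hcardS, hcardR, hcardB] at hpi
    refine (uprob_mono ?_).trans hpi
    rintro g ⟨hfg, -, hno⟩ a ha x hx
    have ha : (a : Fin n) ∈ S := by simpa using ha
    obtain ⟨q, hTq, hqτ, hωq, hlt⟩ := (hβ a ha).2 x hx
    have hgq : (act g ω q : Sym2 (Fin n)) = s((a : Fin n), (g a x : Fin n)) := hπ g _ a x hωq
    by_contra hxR
    have hxR : ((g a x : {x // x ∈ B}) : Fin n) ∉ R := by simpa using hxR
    refine hno a ha (g a x) (Finset.mem_sdiff.mpr ⟨(g a x).2, hxR⟩) ⟨act g ω q, ?_, hgq⟩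
    have haU : (a : Fin n) ∈ U := (Finset.mem_filter.mp a.2).1
    have hxU : ((g a x : {x // x ∈ B}) : Fin n) ∈ U := (Finset.mem_filter.mp (g a x).2).1
    refine mem_build_of_few_seen hc hk hpar (act g ω) (fun j => ?_) hbud hTq
      ((crossing_iff hgq).mpr ?_) ?_ (v := a) ?_ (lt_of_le_of_lt (Finset.card_le_card ?_) hlt) hqτ
    · rw [freeSide, hfg]; exact hU j
    · rw [hcA _ a.2, hcB _ (g a x).2]; simp
    · rw [hfg, hgq]
      intro v hv
      rcases Sym2.mem_iff.mp hv with rfl | rfl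
      · exact haU
      · exact hxU
    · rw [hgq]; exact Sym2.mem_mk_left _ _
    · intro p hp
      simp only [Finset.mem_filter, Finset.mem_univ, true_and, hfg] at hp ⊢
      obtain ⟨hTp, hpq, hcp, hap, hpU⟩ := hp
      refine ⟨⟨hTp, lt_trans hpq hqτ, ?_⟩, hpq⟩
      rw [← hjoin g _ a a.2, ← hact]
      obtain ⟨w, hw⟩ := hap
      refine ⟨w, Finset.mem_filter.mpr ⟨hpU w (by rw [hw]; exact Sym2.mem_mk_right _ _), ?_⟩, hw⟩
      have := (crossing_iff hw).mp hcp
      rw [hcA _ a.2] at this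
      revert this
      cases c w <;> cases i <;> simp
  have hfin := uprob_le_of_average act hinj
    (fun ω => free c (build n b (pmStrategy c k K T) ω T) = U ∧
      (∀ a ∈ S, K ≤ (Finset.univ.filter (fun q : Fin (Fintype.card (CEdge n)) =>
        T ≤ (q : ℕ) ∧ (q : ℕ) < τ ∧ JoinsTo a B (ω q))).card) ∧
      ∀ a ∈ S, ∀ w ∈ B \ R, ¬ EdgeAdj (build n b (pmStrategy c k K T) ω τ) a w)
    (fun ω => free c (build n b (pmStrategy c k K T) ω T) = U ∧
      ∀ a ∈ S, K ≤ (Finset.univ.filter (fun q : Fin (Fintype.card (CEdge n)) =>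
        T ≤ (q : ℕ) ∧ (q : ℕ) < τ ∧ JoinsTo a B (ω q))).card) ?_ _ main
  · exact hfin.trans (mul_le_mul_of_nonneg_left (uprob_mono fun ω h => h.1) (by positivity))
  · rintro g ω ⟨h1, h2, _⟩
    rw [hbuild] at h1
    refine ⟨h1, fun a ha => ?_⟩
    have := h2 a ha
    simp only [hact, hjoin g _ a (hS ha)] at this
    exact this

theorem uprob_le_of_fiber {α β : Type} [Fintype α] [Fintype β] (f : α → β) (E : α → Prop)
    (x : ℝ) (hx : 0 ≤ x)
    (h : ∀ u, uprob (fun a => f a = u ∧ E a) ≤ x * uprob (fun a => f a = u)) :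
    uprob E ≤ x := by
  have h1 : ∑ u : β, uprob (fun a => f a = u) ≤ 1 := by
    simp only [uprob_eq]
    rw [← Finset.sum_div]
    apply div_le_one_of_le₀ _ (by positivity)
    rw [← Nat.cast_sum, ← Finset.card_eq_sum_card_fiberwise (fun a _ => Finset.mem_univ (f a)),
      Finset.card_univ]
  calc uprob E ≤ uprob (fun a => ∃ u ∈ Finset.univ, f a = u ∧ E a) :=
        uprob_mono fun a ha => ⟨f a, Finset.mem_univ _, rfl, ha⟩
    _ ≤ ∑ u : β, uprob (fun a => f a = u ∧ E a) := uprob_exists_mem_le _ _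
    _ ≤ ∑ u : β, x * uprob (fun a => f a = u) := Finset.sum_le_sum fun u _ => h u
    _ = x * ∑ u : β, uprob (fun a => f a = u) := by rw [Finset.mul_sum]
    _ ≤ x := mul_le_of_le_one_right hx h1

/-- The union bound over the sets of size at most `(k + 1) / 2` violating Hall's condition. -/
noncomputable def hallSum (k K : ℕ) : ℝ :=
  ∑ s ∈ Finset.range (k + 1), (k.choose s : ℝ) *
    (if 1 ≤ s ∧ 2 * s ≤ k + 1 then
      (k.choose (s - 1) : ℝ) * (((s - 1 : ℕ) : ℝ) / k) ^ (K * s) else 0)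

theorem hallSum_nonneg (k K : ℕ) : 0 ≤ hallSum k K := by
  apply Finset.sum_nonneg
  intro s _
  split_ifs <;> positivity

/-- The event that some small set of uncovered vertices violates Hall's condition although all
uncovered vertices have seen many edges to the other side. -/
theorem uprob_exists_hall_violation_le {n b m k K T τ : ℕ} {c : Fin n → Bool}
    (hc : ∀ i, (Finset.univ.filter (fun v => c v = i)).card = m) (hk : k ≤ m)
    (hpar : Even (m + k)) (hbud : n + 4 * k * K ≤ 2 * b) :
    uprob (fun ω : EdgeOrdering n =>
      (∀ j, (freeSide c (build n b (pmStrategy c k K T) ω T) j).card = k) ∧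
      (∀ v ∈ free c (build n b (pmStrategy c k K T) ω T), K ≤ (Finset.univ.filter
        (fun q : Fin (Fintype.card (CEdge n)) => T ≤ (q : ℕ) ∧ (q : ℕ) < τ ∧
          JoinsTo v (freeSide c (build n b (pmStrategy c k K T) ω T) (!c v)) (ω q))).card) ∧
      ∃ i, ∃ S ⊆ freeSide c (build n b (pmStrategy c k K T) ω T) i,
        ∃ R ⊆ freeSide c (build n b (pmStrategy c k K T) ω T) (!i),
        2 * S.card ≤ k + 1 ∧ R.card + 1 = S.card ∧
        ∀ a ∈ S, ∀ w ∈ freeSide c (build n b (pmStrategy c k K T) ω T) (!i) \ R,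
          ¬ EdgeAdj (build n b (pmStrategy c k K T) ω τ) a w) ≤ 2 * hallSum k K := by
  apply uprob_le_of_fiber (fun ω : EdgeOrdering n => free c (build n b (pmStrategy c k K T) ω T))
    _ _ (mul_nonneg zero_le_two (hallSum_nonneg k K))
  intro U
  set p : ℝ := uprob (fun ω : EdgeOrdering n =>
    free c (build n b (pmStrategy c k K T) ω T) = U) with hp
  have hp0 : 0 ≤ p := uprob_nonneg _
  by_cases hU : ∀ j, (U.filter (fun v => c v = j)).card = k
  swap
  · refine le_trans (le_of_eq ?_) (mul_nonneg (mul_nonneg zero_le_two (hallSum_nonneg k K)) hp0)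
    rw [uprob_eq, Finset.filter_false_of_mem]
    · simp
    · rintro ω - ⟨rfl, h, -⟩
      exact hU h
  let P : Bool → Finset (Fin n) → Finset (Fin n) → EdgeOrdering n → Prop := fun i S R ω =>
      free c (build n b (pmStrategy c k K T) ω T) = U ∧
      (∀ a ∈ S, K ≤ (Finset.univ.filter (fun q : Fin (Fintype.card (CEdge n)) =>
        T ≤ (q : ℕ) ∧ (q : ℕ) < τ ∧
          JoinsTo a (U.filter (fun v => c v = !i)) (ω q))).card) ∧
      ∀ a ∈ S, ∀ w ∈ U.filter (fun v => c v = !i) \ R,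
        ¬ EdgeAdj (build n b (pmStrategy c k K T) ω τ) a w
  have hP : ∀ i, ∀ S ⊆ U.filter (fun v => c v = i), ∀ R ⊆ U.filter (fun v => c v = !i),
      uprob (P i S R) ≤ ((R.card : ℝ) / k) ^ (K * S.card) * p := fun i S hS R hR =>
    uprob_hall_violation_le hc hk hpar hbud U hU i S R hS hR
  have hS : ∀ i, ∀ S ∈ (U.filter (fun v => c v = i)).powerset.filter
      (fun S => 1 ≤ S.card ∧ 2 * S.card ≤ k + 1),
      uprob (fun ω => ∃ R ∈ Finset.powersetCard (S.card - 1) (U.filter (fun v => c v = !i)),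
        P i S R ω) ≤
      (k.choose (S.card - 1) : ℝ) * (((S.card - 1 : ℕ) : ℝ) / k) ^ (K * S.card) * p := by
    intro i S hS
    have := uprob_exists_le (Finset.powersetCard (S.card - 1) (U.filter (fun v => c v = !i)))
      (P i S) ((((S.card - 1 : ℕ) : ℝ) / k) ^ (K * S.card) * p) (by
        intro R hR
        rw [Finset.mem_powersetCard] at hR
        rw [← hR.2]
        exact hP i S (Finset.mem_powerset.mp (Finset.mem_filter.mp hS).1) R hR.1)
    rw [Finset.card_powersetCard, hU] at this
    rw [mul_assoc]
    exact this
  have hi : ∀ i ∈ (Finset.univ : Finset Bool),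
      uprob (fun ω => ∃ S ∈ (U.filter (fun v => c v = i)).powerset.filter
        (fun S => 1 ≤ S.card ∧ 2 * S.card ≤ k + 1),
        ∃ R ∈ Finset.powersetCard (S.card - 1) (U.filter (fun v => c v = !i)), P i S R ω) ≤
      hallSum k K * p := by
    intro i _
    refine (uprob_exists_mem_le _ _).trans ((Finset.sum_le_sum (hS i)).trans (le_of_eq ?_))
    rw [← Finset.sum_mul, Finset.sum_filter]
    congr 1
    have := Finset.sum_powerset_apply_card (x := U.filter (fun v => c v = i))
      (fun s => if 1 ≤ s ∧ 2 * s ≤ k + 1 then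
      (k.choose (s - 1) : ℝ) * (((s - 1 : ℕ) : ℝ) / k) ^ (K * s) else 0)
    rw [hU] at this
    simp only [nsmul_eq_mul] at this
    unfold hallSum
    convert this
  have htot := uprob_exists_le _ _ _ hi
  rw [Finset.card_univ, Fintype.card_bool, ← mul_assoc] at htot
  refine (uprob_mono ?_).trans htot
  rintro ω ⟨hfU, -, hjoin, i, S, hS, R, hR, h2, h1, hno⟩
  simp only [freeSide, hfU] at hjoin hS hR hno
  refine ⟨i, Finset.mem_univ _, S, ?_, R, ?_, hfU, ?_, hno⟩
  · exact Finset.mem_filter.mpr ⟨Finset.mem_powerset.mpr hS, by omega, h2⟩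
  · exact Finset.mem_powersetCard.mpr ⟨hR, by omega⟩
  · intro a ha
    have := Finset.mem_filter.mp (hS ha)
    have h := hjoin a this.1
    rwa [this.2] at h

/-! ### Numerical estimates -/

theorem self_pow_div_factorial_le (s : ℕ) : (s : ℝ) ^ s / s.factorial ≤ 3 ^ s := by
  refine (Real.pow_div_factorial_le_exp (s : ℝ) (Nat.cast_nonneg s) s).trans ?_
  rw [← mul_one (s : ℝ), Real.exp_nat_mul]
  apply pow_le_pow_left₀ (Real.exp_pos 1).le
  have := Real.exp_one_lt_d9
  linarith

theorem hallSum_term_le {k s : ℕ} (hs : 1 ≤ s) (hsk : 2 * s ≤ k + 1) :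
    (k.choose s : ℝ) * ((k.choose (s - 1) : ℝ) * (((s - 1 : ℕ) : ℝ) / k) ^ (12 * s)) ≤
      (1 / 2) ^ s * (1 / k) := by
  obtain ⟨r, rfl⟩ : ∃ r, s = r + 1 := ⟨s - 1, by omega⟩
  rcases Nat.eq_zero_or_pos r with rfl | hr
  · simp
  have hk : (0 : ℝ) < k := by exact_mod_cast (by omega : 0 < k)
  simp only [Nat.add_sub_cancel]
  set s : ℕ := r + 1 with hsr
  set x : ℝ := (s : ℝ) / k with hx
  have hx0 : 0 < x := by rw [hx]; positivity
  have hx1 : x ≤ 2 / 3 := by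
    rw [hx, div_le_div_iff₀ hk (by norm_num)]
    have : s * 3 ≤ 2 * k := by omega
    exact_mod_cast this
  set a : ℝ := (k : ℝ) ^ s / s.factorial with ha
  have ha0 : 0 < a := by rw [ha]; positivity
  have hax : a * x ^ s ≤ 3 ^ s := by
    refine le_trans (le_of_eq ?_) (self_pow_div_factorial_le s)
    rw [ha, hx, div_pow]
    field_simp
  have h1 : (k.choose s : ℝ) ≤ a := Nat.choose_le_pow_div s k
  have h2 : (k.choose r : ℝ) ≤ a * x := by
    refine (Nat.choose_le_pow_div r k).trans (le_of_eq ?_)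
    rw [ha, hx, hsr, Nat.factorial_succ, pow_succ]
    push_cast
    field_simp
  have h3 : ((r : ℝ) / k) ^ (12 * s) ≤ x ^ (12 * s) := by
    apply pow_le_pow_left₀ (by positivity)
    rw [hx]
    apply div_le_div_of_nonneg_right _ hk.le
    exact_mod_cast (by omega : r ≤ s)
  have h4 : x ^ 10 ≤ (2 / 3) ^ 10 := pow_le_pow_left₀ hx0.le hx1 _
  have h5 : (s : ℝ) ≤ 2 ^ s := by exact_mod_cast Nat.lt_two_pow_self.le
  calc _ ≤ a * (a * x * x ^ (12 * s)) := by gcongr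
    _ = (a * x ^ s) ^ 2 * (x ^ 10) ^ s * x := by ring
    _ ≤ (3 ^ s) ^ 2 * ((2 / 3) ^ 10) ^ s * x := by gcongr
    _ = (9 * (2 / 3) ^ 10) ^ s * x := by rw [mul_pow, ← pow_mul, mul_comm s 2, pow_mul]; norm_num
    _ ≤ (1 / 4) ^ s * x := by gcongr; norm_num
    _ = (1 / 2) ^ s * ((1 / 2) ^ s * s) * (1 / k) := by
        rw [← mul_assoc, ← mul_pow, hx]; norm_num; ring
    _ ≤ (1 / 2) ^ s * 1 * (1 / k) := by
        gcongr
        rw [one_div_pow, one_div, inv_mul_le_iff₀ (by positivity)]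
        simpa using h5
    _ = _ := by ring

theorem hallSum_le (k : ℕ) : hallSum k 12 ≤ 2 / k := by
  have h : ∀ s ∈ Finset.range (k + 1), (k.choose s : ℝ) *
      (if 1 ≤ s ∧ 2 * s ≤ k + 1 then
        (k.choose (s - 1) : ℝ) * (((s - 1 : ℕ) : ℝ) / k) ^ (12 * s) else 0) ≤
      (1 / 2) ^ s * (1 / k) := by
    intro s _
    split_ifs with hs
    · exact hallSum_term_le hs.1 hs.2
    · rw [mul_zero]; positivity
  refine (Finset.sum_le_sum h).trans ?_
  rw [← Finset.sum_mul]
  have := sum_geometric_two_le (k + 1)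
  calc _ ≤ 2 * (1 / (k : ℝ)) := by gcongr
    _ = _ := by ring

/-! ### The success probability of the strategy -/

theorem card_filter_Ico_fin {N a b : ℕ} (h : b ≤ N) :
    (Finset.univ.filter (fun q : Fin N => a ≤ (q : ℕ) ∧ (q : ℕ) < b)).card = b - a := by
  rw [← Nat.card_Ico, ← Finset.card_map Fin.valEmbedding]
  congr 1
  ext x
  simp only [Finset.mem_map, Finset.mem_filter, Finset.mem_univ, true_and, Finset.mem_Ico]
  constructor
  · rintro ⟨q, hq, rfl⟩
    exact hq
  · intro hx
    exact ⟨⟨x, by omega⟩, hx, rfl⟩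

theorem uprob_few_seen_le {n b k K T W : ℕ} {c : Fin n → Bool} (h : ℕ)
    (hkN : k ≤ Fintype.card (CEdge n)) (hTW : T + K * W ≤ Fintype.card (CEdge n)) :
    uprob (fun ω : EdgeOrdering n =>
      (∀ j, (freeSide c (build n b (pmStrategy c k K T) ω T) j).card = k) ∧
      (∀ v : Fin n, (Finset.univ.filter (fun q : Fin (Fintype.card (CEdge n)) =>
        (q : ℕ) < T ∧ v ∈ (ω q : Sym2 (Fin n)))).card < h) ∧
      ∃ v : Fin n, (Finset.univ.filter (fun q : Fin (Fintype.card (CEdge n)) =>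
        T ≤ (q : ℕ) ∧ (q : ℕ) < T + K * W ∧
          JoinsTo v (freeSide c (build n b (pmStrategy c k K T) ω T) (!c v)) (ω q))).card < K) ≤
      n * (K * (1 - ((k - h : ℕ) : ℝ) / Fintype.card (CEdge n)) ^ W) := by
  let I : ℕ → Finset (Fin (Fintype.card (CEdge n))) := fun i =>
    Finset.univ.filter (fun q : Fin (Fintype.card (CEdge n)) =>
      T + i * W ≤ (q : ℕ) ∧ (q : ℕ) < T + (i + 1) * W)
  have hle : ∀ i < K, T + (i + 1) * W ≤ T + K * W := fun i hi =>
    Nat.add_le_add_left (Nat.mul_le_mul_right W hi) T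
  have hI : ∀ i < K, (I i).card = W := by
    intro i hi
    rw [card_filter_Ico_fin ((hle i hi).trans hTW), add_one_mul]
    omega
  let Q : Fin n → ℕ → EdgeOrdering n → Prop := fun v i ω =>
      (freeSide c (build n b (pmStrategy c k K T) ω T) (!c v)).card = k ∧
      (Finset.univ.filter (fun q : Fin (Fintype.card (CEdge n)) =>
        (q : ℕ) < T ∧ v ∈ (ω q : Sym2 (Fin n)))).card < h ∧
      ∀ q ∈ I i, ¬ JoinsTo v (freeSide c (build n b (pmStrategy c k K T) ω T) (!c v)) (ω q)
  have h1 : ∀ v ∈ (Finset.univ : Finset (Fin n)),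
      uprob (fun ω => ∃ i ∈ Finset.range K, Q v i ω) ≤
        K * (1 - ((k - h : ℕ) : ℝ) / Fintype.card (CEdge n)) ^ W := by
    intro v _
    have := uprob_exists_le (Finset.range K) (Q v)
      ((1 - ((k - h : ℕ) : ℝ) / Fintype.card (CEdge n)) ^ W) (by
        intro i hi
        rw [← hI i (Finset.mem_range.mp hi)]
        exact uprob_window_misses_le h v (I i)
          (fun q hq => (Nat.le_add_right _ _).trans (Finset.mem_filter.mp hq).2.1) hkN)
    rwa [Finset.card_range] at this
  have h2 := uprob_exists_le _ _ _ h1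
  rw [Finset.card_univ, Fintype.card_fin] at h2
  refine (uprob_mono ?_).trans h2
  rintro ω ⟨hk, hd, v, hv⟩
  refine ⟨v, Finset.mem_univ _, ?_⟩
  by_contra hcon
  refine absurd hv (not_lt.mpr ?_)
  have hex : ∀ i : Fin K, ∃ q ∈ I i,
      JoinsTo v (freeSide c (build n b (pmStrategy c k K T) ω T) (!c v)) (ω q) := by
    intro i
    by_contra hno
    push Not at hno
    exact hcon ⟨i, Finset.mem_range.mpr i.2, hk _, hd v, hno⟩
  choose f hf hfj using hex
  have hfI : ∀ i : Fin K, T + i * W ≤ (f i : ℕ) ∧ (f i : ℕ) < T + (i + 1) * W := fun i =>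
    (Finset.mem_filter.mp (hf i)).2
  have hinj : Function.Injective f := by
    have hlt : ∀ i j : Fin K, i < j → f i ≠ f j := by
      intro i j hij heq
      have h1 := (hfI i).2
      have h2 := (hfI j).1
      have h3 : ((i : ℕ) + 1) * W ≤ j * W := Nat.mul_le_mul_right W hij
      rw [heq] at h1
      omega
    intro i j hij
    rcases lt_trichotomy i j with h | h | h
    · exact absurd hij (hlt i j h)
    · exact h
    · exact absurd hij.symm (hlt j i h)
  calc K = (Finset.univ.image f).card := by
        rw [Finset.card_image_of_injective _ hinj, Finset.card_univ, Fintype.card_fin]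
    _ ≤ _ := by
        apply Finset.card_le_card
        intro q hq
        obtain ⟨i, _, rfl⟩ := Finset.mem_image.mp hq
        have := hle i i.2
        have := hfI i
        simp only [Finset.mem_filter, Finset.mem_univ, true_and]
        exact ⟨by omega, by omega, hfj i⟩

theorem one_sub_le_uprob_hasPerfectMatching {n b m k K T W t : ℕ} {c : Fin n → Bool} (h : ℕ)
    (hc : ∀ i, (Finset.univ.filter (fun v => c v = i)).card = m) (hk : k ≤ m)
    (hpar : Even (m + k)) (hbud : n + 4 * k * K ≤ 2 * b)
    (hkN : (k + 1).choose 2 ≤ Fintype.card (CEdge n)) (hkN' : k ≤ Fintype.card (CEdge n))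
    (hTW : T + K * W ≤ Fintype.card (CEdge n)) (ht : T + K * W ≤ t) :
    1 - (2 ^ n * (1 - ((k + 1).choose 2 : ℝ) / Fintype.card (CEdge n)) ^ T +
      (n * (2 ^ T * ((n : ℝ) / Fintype.card (CEdge n)) ^ h) +
      (n * (K * (1 - ((k - h : ℕ) : ℝ) / Fintype.card (CEdge n)) ^ W) + 2 * hallSum k K))) ≤
    uprob (fun ω : EdgeOrdering n =>
      hasPerfectMatching n (build n b (pmStrategy c k K T) ω t)) := by
  have : Nonempty (EdgeOrdering n) := ⟨(Fintype.equivFin _).symm⟩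
  have e1 := uprob_greedy_fails_le (b := b) (K := K) hc hk hpar (by omega)
    ((Nat.le_add_right _ _).trans hTW) hkN
  have e2 := uprob_large_degree_le h ((Nat.le_add_right _ _).trans hTW)
  have e3 := uprob_few_seen_le (b := b) (c := c) h hkN' hTW
  have e4 := uprob_exists_hall_violation_le (τ := T + K * W) (T := T) hc hk hpar hbud
  refine le_trans (sub_le_sub_left ((uprob_or_le _ _).trans (add_le_add e1
    ((uprob_or_le _ _).trans (add_le_add e2
      ((uprob_or_le _ _).trans (add_le_add e3 e4)))))) 1) (one_sub_le_uprob ?_)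
  intro ω hno
  by_contra hcon
  push Not at hcon
  obtain ⟨g1, g2, g3, g4⟩ := hcon
  have g3 : ∀ v : Fin n, K ≤ (Finset.univ.filter (fun q : Fin (Fintype.card (CEdge n)) =>
        T ≤ (q : ℕ) ∧ (q : ℕ) < T + K * W ∧
          JoinsTo v (freeSide c (build n b (pmStrategy c k K T) ω T) (!c v)) (ω q))).card :=
    g3 g1 g2
  have g4 := g4 g1 (fun v _ => g3 v)
  have hinv : GreedyInv c k (build n b (pmStrategy c k K T) ω T) :=
    greedyInv_build hc hk hpar ω le_rfl
  apply hno
  refine hasPerfectMatching_of_hall c (build n b (pmStrategy c k K T) ω T) _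
    (build_mono ((Nat.le_add_right _ _).trans ht)) hinv.mono hinv.disj
    ((g1 true).trans (g1 false).symm) ?_
  have hmono : build n b (pmStrategy c k K T) ω (T + K * W) ⊆
      build n b (pmStrategy c k K T) ω t := build_mono ht
  have hall := card_le_card_nbhd_of_half (EdgeAdj (build n b (pmStrategy c k K T) ω t)) _ _ k
    (g1 true) (g1 false) (fun S hS R hR h2 h1 => by
      obtain ⟨a, ha, w, hw, e, he, hew⟩ := g4 true S hS R hR h2 h1
      exact ⟨a, ha, w, by convert hw; rfl, e, hmono he, hew⟩) (fun S hS R hR h2 h1 => by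
      obtain ⟨a, ha, w, hw, e, he, hew⟩ := g4 false S hS R hR h2 h1
      exact ⟨a, ha, w, by convert hw; rfl, EdgeAdj.symm ⟨e, hmono he, hew⟩⟩)
  intro S hS
  convert hall S hS

theorem one_sub_pow_le_exp {x y : ℝ} (hx : x ≤ 1) (hy : y ≤ x) (n : ℕ) :
    (1 - x) ^ n ≤ Real.exp (-(n * y)) := by
  rw [← mul_neg, Real.exp_nat_mul]
  apply pow_le_pow_left₀ (by linarith)
  exact (sub_le_sub_left hy 1).trans (Real.one_sub_le_exp_neg y)

theorem exp_neg_le_inv {m : ℕ} (hm : 0 < m) : Real.exp (-(m : ℝ)) ≤ 1 / m := by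
  have h : (0 : ℝ) < m := by exact_mod_cast hm
  rw [Real.exp_neg, ← one_div]
  apply one_div_le_one_div_of_le h
  linarith [Real.add_one_le_exp (m : ℝ)]

theorem greedy_error_le {m k D N : ℕ} (hm : 0 < m) (hD : 0 < D) (hmk : m ≤ D * k)
    (hN0 : 0 < N) (hN : N ≤ 2 * m ^ 2) (hkN : (k + 1).choose 2 ≤ N) :
    (2 : ℝ) ^ (2 * m) * (1 - ((k + 1).choose 2 : ℝ) / N) ^ (12 * D ^ 2 * m) ≤ 1 / m := by
  have hD' : (0 : ℝ) < D := by exact_mod_cast hD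
  have hN' : (0 : ℝ) < N := by exact_mod_cast hN0
  have h1 : (1 : ℝ) / (4 * D ^ 2) ≤ ((k + 1).choose 2 : ℝ) / N := by
    rw [div_le_div_iff₀ (by positivity) hN', Nat.cast_choose_two]
    have h2 : (N : ℝ) ≤ 2 * m ^ 2 := by exact_mod_cast hN
    have h3 : (m : ℝ) ≤ D * k := by exact_mod_cast hmk
    have h4 : (m : ℝ) ^ 2 ≤ (D * k) ^ 2 := pow_le_pow_left₀ (by positivity) h3 2
    push_cast
    have : (0 : ℝ) ≤ D ^ 2 * k := by positivity
    nlinarith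
  have h2 := one_sub_pow_le_exp (div_le_one_of_le₀ (by exact_mod_cast hkN) hN'.le) h1
    (12 * D ^ 2 * m)
  have h3 : -(((12 * D ^ 2 * m : ℕ) : ℝ) * (1 / (4 * D ^ 2))) = -(3 * m : ℝ) := by
    push_cast
    field_simp
    norm_num
  rw [h3] at h2
  have h4 : (2 : ℝ) ^ (2 * m) ≤ Real.exp (2 * m) := by
    have := pow_le_pow_left₀ (by norm_num) (show (2 : ℝ) ≤ Real.exp 1 by
      linarith [Real.add_one_le_exp (1 : ℝ)]) (2 * m)
    rwa [← Real.exp_nat_mul, Nat.cast_mul, Nat.cast_ofNat, mul_one] at this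
  calc _ ≤ Real.exp (2 * m) * Real.exp (-(3 * m)) :=
        mul_le_mul h4 h2 (pow_nonneg (sub_nonneg.mpr
          (div_le_one_of_le₀ (by exact_mod_cast hkN) hN'.le)) _) (Real.exp_pos _).le
    _ = Real.exp (-(m : ℝ)) := by rw [← Real.exp_add]; congr 1; ring
    _ ≤ _ := exp_neg_le_inv hm

theorem degree_error_le {m h D N : ℕ} (hm : 0 < m) (hmh : m ≤ 2 * D * h) (hN : m ^ 2 ≤ N)
    (hlarge : (2 : ℝ) / m ≤ Real.exp (-(2 * D * (12 * D ^ 2 + 2)))) :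
    ((2 * m : ℕ) : ℝ) * (2 ^ (12 * D ^ 2 * m) * (((2 * m : ℕ) : ℝ) / N) ^ h) ≤ 1 / m := by
  have hm' : (0 : ℝ) < m := by exact_mod_cast hm
  have hN' : (m : ℝ) ^ 2 ≤ N := by exact_mod_cast hN
  have h1 : ((2 * m : ℕ) : ℝ) / N ≤ Real.exp (-(2 * D * (12 * D ^ 2 + 2))) := by
    refine le_trans ?_ hlarge
    rw [div_le_div_iff₀ (by nlinarith) hm']
    push_cast
    nlinarith
  have h2 : (((2 * m : ℕ) : ℝ) / N) ^ h ≤ Real.exp (-(m * (12 * D ^ 2 + 2))) := by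
    refine (pow_le_pow_left₀ (by positivity) h1 h).trans ?_
    rw [← Real.exp_nat_mul]
    apply Real.exp_le_exp.mpr
    have : (m : ℝ) ≤ 2 * D * h := by exact_mod_cast hmh
    have h3 : (0 : ℝ) ≤ 12 * D ^ 2 + 2 := by positivity
    nlinarith [mul_le_mul_of_nonneg_right this h3]
  have h3 : (2 : ℝ) ^ (12 * D ^ 2 * m) ≤ Real.exp (12 * D ^ 2 * m) := by
    have := pow_le_pow_left₀ (by norm_num) (show (2 : ℝ) ≤ Real.exp 1 by
      linarith [Real.add_one_le_exp (1 : ℝ)]) (12 * D ^ 2 * m)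
    rw [← Real.exp_nat_mul] at this
    simpa using this
  have h4 : (m : ℝ) ≤ Real.exp m := by linarith [Real.add_one_le_exp (m : ℝ)]
  have h5 : 2 * (m : ℝ) ^ 2 ≤ Real.exp (2 * m) := by
    have := Real.quadratic_le_exp_of_nonneg (show (0 : ℝ) ≤ 2 * m by positivity)
    nlinarith
  calc _ ≤ ((2 * m : ℕ) : ℝ) * (Real.exp (12 * D ^ 2 * m) *
        Real.exp (-(m * (12 * D ^ 2 + 2)))) := by gcongr
    _ = 2 * m * Real.exp (-(2 * m)) := by
        rw [← Real.exp_add]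
        push_cast
        congr 2
        ring
    _ ≤ 1 / m := by
        rw [Real.exp_neg, ← div_eq_mul_inv, div_le_div_iff₀ (Real.exp_pos _) hm']
        linarith

theorem window_error_le {m k h D N W : ℕ} (hm : 0 < m) (hD : 0 < D) (hmk : m ≤ 4 * D * (k - h))
    (hN0 : 0 < N) (hN : N ≤ 2 * m ^ 2) (hkN : k ≤ N) (hW : 16 * D * m * Real.log m ≤ W) :
    ((2 * m : ℕ) : ℝ) * ((12 : ℕ) * (1 - ((k - h : ℕ) : ℝ) / N) ^ W) ≤ 24 / m := by
  have hm' : (0 : ℝ) < m := by exact_mod_cast hm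
  have hD' : (0 : ℝ) < D := by exact_mod_cast hD
  have hN' : (0 : ℝ) < N := by exact_mod_cast hN0
  have h1 : (1 : ℝ) / (8 * D * m) ≤ ((k - h : ℕ) : ℝ) / N := by
    rw [div_le_div_iff₀ (by positivity) hN']
    have h2 : (N : ℝ) ≤ 2 * m ^ 2 := by exact_mod_cast hN
    have h3 : (m : ℝ) ≤ 4 * D * (k - h : ℕ) := by exact_mod_cast hmk
    nlinarith
  have h2 := one_sub_pow_le_exp (div_le_one_of_le₀ (by exact_mod_cast (by omega)) hN'.le) h1 W
  have h3 : 2 * Real.log m ≤ W * (1 / (8 * D * m)) := by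
    rw [mul_one_div, le_div_iff₀ (by positivity)]
    linarith
  have h4 : (1 - ((k - h : ℕ) : ℝ) / N) ^ W ≤ 1 / (m : ℝ) ^ 2 := by
    refine h2.trans ((Real.exp_le_exp.mpr (neg_le_neg h3)).trans (le_of_eq ?_))
    rw [Real.exp_neg, mul_comm, Real.exp_mul, Real.exp_log hm', one_div]
    norm_num
  calc _ ≤ ((2 * m : ℕ) : ℝ) * ((12 : ℕ) * (1 / (m : ℝ) ^ 2)) := by gcongr
    _ = 24 / m := by push_cast; field_simp; norm_num

theorem hallSum_error_le {m k D : ℕ} (hm : 0 < m) (hmk : m ≤ D * k) :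
    2 * hallSum k 12 ≤ 4 * D / m := by
  have hm' : (0 : ℝ) < m := by exact_mod_cast hm
  have hk : (0 : ℝ) < k := by
    exact_mod_cast Nat.pos_of_ne_zero (by rintro rfl; omega)
  calc _ ≤ 2 * (2 / (k : ℝ)) := by gcongr; exact hallSum_le k
    _ = 4 / k := by ring
    _ ≤ _ := by
      rw [div_le_div_iff₀ hk hm']
      have : (m : ℝ) ≤ D * k := by exact_mod_cast hmk
      linarith

/-! ### The choice of parameters and the main theorem -/

theorem card_cedge (n : ℕ) : Fintype.card (CEdge n) = n.choose 2 := by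
  have h := Sym2.card_subtype_not_diag (α := Fin n)
  rw [Fintype.card_fin] at h
  rw [← h]

theorem card_cedge_two_mul_add (m : ℕ) : Fintype.card (CEdge (2 * m)) + m = 2 * m ^ 2 := by
  rw [card_cedge, Nat.choose_two_right]
  obtain rfl | hm := Nat.eq_zero_or_pos m
  · rfl
  · rw [mul_assoc, Nat.mul_div_cancel_left _ two_pos, pow_two]
    obtain ⟨j, rfl⟩ : ∃ j, m = j + 1 := ⟨m - 1, by omega⟩
    rw [show 2 * (j + 1) - 1 = 2 * j + 1 by omega]
    ring

theorem exists_free_count {d m : ℕ} (hd : 0 < d) (hm : 4 * d ≤ m) :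
    ∃ k, Even (m + k) ∧ d * k ≤ m ∧ m ≤ 2 * d * k ∧ 2 ≤ k := by
  have h4 : 4 ≤ m / d := (Nat.le_div_iff_mul_le hd).mpr hm
  have hle : d * (m / d) ≤ m := Nat.mul_div_le m d
  have hlt : m < d * (m / d + 1) := Nat.lt_mul_div_succ m hd
  generalize m / d = q at h4 hle hlt
  obtain hp | hp := Nat.even_or_odd (m + q)
  · exact ⟨q, hp, hle, by nlinarith, by omega⟩
  · obtain ⟨j, rfl⟩ : ∃ j, q = j + 1 := ⟨q - 1, by omega⟩
    refine ⟨j, ?_, by nlinarith, by nlinarith, by omega⟩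
    rw [← add_assoc, Nat.odd_add_one, Nat.not_odd_iff_even] at hp
    exact hp

theorem card_filter_halves (m : ℕ) (i : Bool) :
    (Finset.univ.filter (fun v : Fin (2 * m) => decide ((v : ℕ) < m) = i)).card = m := by
  have h := card_filter_Ico_fin (N := 2 * m) (a := 0) (b := m) (by omega)
  have h' := card_filter_Ico_fin (N := 2 * m) (a := m) (b := 2 * m) le_rfl
  cases i
  · rw [show 2 * m - m = m by omega] at h'
    refine Eq.trans (congrArg Finset.card ?_) h'
    ext v
    simp
  · rw [Nat.sub_zero] at h
    refine Eq.trans (congrArg Finset.card ?_) h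
    ext v
    simp

theorem eventually_parameters_large (D : ℕ) : ∀ᶠ m : ℕ in atTop,
    2 * D ≤ m ∧ 2 ≤ m ∧ 12 * (D : ℝ) ^ 2 + 12 + 192 * D * Real.log m ≤ m ∧
      (2 : ℝ) / m ≤ Real.exp (-(2 * D * (12 * D ^ 2 + 2))) := by
  have hlog : Tendsto (fun x : ℝ => (12 * (D : ℝ) ^ 2 + 12 + 192 * D * Real.log x) / x)
      atTop (nhds 0) := by
    have h1 : Tendsto (fun x : ℝ => Real.log x / x) atTop (nhds 0) :=
      Real.isLittleO_log_id_atTop.tendsto_div_nhds_zero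
    have h2 : Tendsto (fun x : ℝ => (12 * (D : ℝ) ^ 2 + 12) / x) atTop (nhds 0) :=
      tendsto_const_nhds.div_atTop tendsto_id
    have h3 := h2.add (h1.const_mul (192 * (D : ℝ)))
    rw [mul_zero, add_zero] at h3
    refine h3.congr fun x => ?_
    ring
  have hlog' := (hlog.comp tendsto_natCast_atTop_atTop).eventually_le_const
    (show (0 : ℝ) < 1 by norm_num)
  have hexp : Tendsto (fun m : ℕ => (2 : ℝ) / m) atTop (nhds 0) :=
    tendsto_const_nhds.div_atTop tendsto_natCast_atTop_atTop
  have hexp' := hexp.eventually_le_const (Real.exp_pos (-(2 * (D : ℝ) * (12 * (D : ℝ) ^ 2 + 2))))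
  filter_upwards [eventually_ge_atTop (2 * D), eventually_ge_atTop 2, hlog', hexp']
    with m h1 h2 h3 h4
  refine ⟨h1, h2, ?_, h4⟩
  have hm : (0 : ℝ) < m := by exact_mod_cast (show 0 < m by omega)
  have h5 : (12 * (D : ℝ) ^ 2 + 12 + 192 * D * Real.log m) / m ≤ 1 := h3
  rwa [div_le_one hm] at h5

theorem one_sub_div_le_uprob_hasPerfectMatching {m d k t b : ℕ} (hd : 0 < d)
    (hlarge : 2 * (2 * d) ≤ m) (hm2 : 2 ≤ m)
    (hlog : 12 * ((2 * d : ℕ) : ℝ) ^ 2 + 12 + 192 * (2 * d : ℕ) * Real.log m ≤ m)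
    (hexp : (2 : ℝ) / m ≤
      Real.exp (-(2 * (2 * d : ℕ) * (12 * ((2 * d : ℕ) : ℝ) ^ 2 + 2))))
    (hpar : Even (m + k)) (hdk : d * k ≤ m) (hmk : m ≤ 2 * d * k) (hk2 : 2 ≤ k)
    (hb : 2 * m + 48 * k ≤ 2 * b)
    (ht : (m : ℝ) * (12 * ((2 * d : ℕ) : ℝ) ^ 2 + 12 + 192 * (2 * d : ℕ) * Real.log m) ≤ t) :
    1 - (26 + 4 * ((2 * d : ℕ) : ℝ)) / m ≤
      uprob (fun ω : EdgeOrdering (2 * m) => hasPerfectMatching (2 * m)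
        (build (2 * m) b (pmStrategy (fun v : Fin (2 * m) => decide ((v : ℕ) < m)) k 12
          (12 * (2 * d) ^ 2 * m)) ω t)) := by
  have hN := card_cedge_two_mul_add m
  have hchoose : (k + 1).choose 2 ≤ Fintype.card (CEdge (2 * m)) := by
    rw [card_cedge]
    apply Nat.choose_le_choose
    nlinarith
  have hmpos : 0 < m := by omega
  have hD : 0 < 2 * d := by omega
  have hkm : k ≤ m := by nlinarith
  have hNle : Fintype.card (CEdge (2 * m)) ≤ 2 * m ^ 2 := by omega
  have hNge : m ^ 2 ≤ Fintype.card (CEdge (2 * m)) := by nlinarith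
  have hkN : k ≤ Fintype.card (CEdge (2 * m)) := by nlinarith
  have hN0 : 0 < Fintype.card (CEdge (2 * m)) := by omega
  have hmR : (2 : ℝ) ≤ m := by exact_mod_cast hm2
  have hlog0 : 0 ≤ Real.log m := Real.log_nonneg (by linarith)
  generalize 2 * d = D at *
  have hW0 : (0 : ℝ) ≤ 16 * D * m * Real.log m := by positivity
  have hW1 := Nat.le_ceil (16 * (D : ℝ) * m * Real.log m)
  have hW2 := (Nat.ceil_lt_add_one hW0).le
  generalize ⌈16 * (D : ℝ) * m * Real.log m⌉₊ = W at hW1 hW2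
  have hTWR : ((12 * D ^ 2 * m + 12 * W : ℕ) : ℝ) ≤
      m * (12 * (D : ℝ) ^ 2 + 12 + 192 * D * Real.log m) := by
    push_cast
    nlinarith
  have hTWt : 12 * D ^ 2 * m + 12 * W ≤ t := by exact_mod_cast hTWR.trans ht
  have hTWm : 12 * D ^ 2 * m + 12 * W ≤ m ^ 2 := by
    have : ((12 * D ^ 2 * m + 12 * W : ℕ) : ℝ) ≤ ((m ^ 2 : ℕ) : ℝ) := by
      refine hTWR.trans ?_
      push_cast
      nlinarith
    exact_mod_cast this
  have hh : k ≤ 2 * ((k + 1) / 2) := by omega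
  have hh' : k ≤ 4 * (k - (k + 1) / 2) := by omega
  have e1 := greedy_error_le hmpos hD hmk hN0 hNle hchoose
  have e2 := degree_error_le (h := (k + 1) / 2) (D := D) hmpos (by nlinarith) hNge hexp
  have e3 := window_error_le (h := (k + 1) / 2) hmpos hD (by nlinarith) hN0 hNle hkN hW1
  have e4 := hallSum_error_le hmpos hmk
  have key := one_sub_le_uprob_hasPerfectMatching (b := b) (t := t) (K := 12) (W := W)
    (T := 12 * D ^ 2 * m) ((k + 1) / 2) (card_filter_halves m) hkm hpar (by omega) hchoose hkN
    (hTWm.trans hNge) hTWt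
  refine le_trans ?_ key
  have : (26 + 4 * (D : ℝ)) / m = 1 / m + (1 / m + (24 / m + 4 * D / m)) := by
    field_simp
    ring
  rw [this]
  linarith

/-- Perfect matchings, optimal budget: for every `ε > 0` there is `C > 0` such that for even
`n`, if `t ≥ C n log n` and `b ≥ (1+ε) n / 2`, Builder has a `(t,b)`-strategy whose purchased
graph contains a perfect matching with high probability (`n = 2m` runs over even numbers). -/
theorem stmt4 (ε : ℝ) (hε : 0 < ε) :
    ∃ C : ℝ, 0 < C ∧
      ∀ t b : ℕ → ℕ,
        (∀ n : ℕ, C * n * Real.log n ≤ (t n : ℝ)) →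
        (∀ n : ℕ, (1 + ε) * n / 2 ≤ (b n : ℝ)) →
        ∃ S : (n : ℕ) → Strategy n,
          Tendsto
            (fun m => uprob (fun ω : EdgeOrdering (2 * m) =>
              hasPerfectMatching (2 * m)
                (build (2 * m) (b (2 * m)) (S (2 * m)) ω (t (2 * m)))))
            atTop (nhds 1) := by
  obtain ⟨d, hd⟩ := exists_nat_gt (24 / ε)
  have hd0 : 0 < d := by
    have : (0 : ℝ) < d := (by positivity : (0 : ℝ) < 24 / ε).trans hd
    exact_mod_cast this
  have hex : ∀ m, ∃ k, 4 * d ≤ m → Even (m + k) ∧ d * k ≤ m ∧ m ≤ 2 * d * k ∧ 2 ≤ k := by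
    intro m
    by_cases hm : 4 * d ≤ m
    · obtain ⟨k, hk⟩ := exists_free_count hd0 hm
      exact ⟨k, fun _ => hk⟩
    · exact ⟨0, fun h => absurd h hm⟩
  choose κ hκ using hex
  refine ⟨12 * ((2 * d : ℕ) : ℝ) ^ 2 + 12 + 192 * (2 * d : ℕ), by positivity, ?_⟩
  intro t b ht hb
  refine ⟨fun n => pmStrategy (fun v : Fin n => decide ((v : ℕ) < n / 2)) (κ (n / 2)) 12
    (12 * (2 * d) ^ 2 * (n / 2)), ?_⟩
  have hlim : Tendsto (fun m : ℕ => 1 - (26 + 4 * ((2 * d : ℕ) : ℝ)) / m) atTop (nhds 1) := by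
    have h := (tendsto_const_nhds (x := (1 : ℝ))).sub
      ((tendsto_const_nhds (x := 26 + 4 * ((2 * d : ℕ) : ℝ))).div_atTop
        tendsto_natCast_atTop_atTop)
    rwa [sub_zero] at h
  refine tendsto_of_tendsto_of_tendsto_of_le_of_le' hlim tendsto_const_nhds ?_
    (Eventually.of_forall fun m => uprob_le_one _)
  filter_upwards [eventually_parameters_large (2 * d)] with m hm
  obtain ⟨h1, h2, h3, h4⟩ := hm
  obtain ⟨hpar, hdk, hmk, hk2⟩ := hκ m (by omega)
  have hhalf : 2 * m / 2 = m := by omega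
  rw [hhalf]
  have hmR : (2 : ℝ) ≤ m := by exact_mod_cast h2
  apply one_sub_div_le_uprob_hasPerfectMatching hd0 h1 h2 h3 h4 hpar hdk hmk hk2
  · have hb' := hb (2 * m)
    have hdk' : (d : ℝ) * κ m ≤ m := by exact_mod_cast hdk
    have hdε : 24 < d * ε := by rwa [div_lt_iff₀ hε] at hd
    have hκε : 24 * (κ m : ℝ) ≤ ε * m := by
      have : (0 : ℝ) ≤ κ m := Nat.cast_nonneg _
      nlinarith
    push_cast at hb'
    have : ((2 * m + 48 * κ m : ℕ) : ℝ) ≤ ((2 * b (2 * m) : ℕ) : ℝ) := by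
      push_cast
      linarith
    exact_mod_cast this
  · refine le_trans ?_ (ht (2 * m))
    have hl1 : Real.log m ≤ Real.log (2 * m : ℕ) := by
      apply Real.log_le_log (by linarith)
      push_cast
      linarith
    have hl2 : 1 ≤ Real.log (2 * m : ℕ) := by
      rw [Real.le_log_iff_exp_le (by push_cast; linarith)]
      push_cast
      linarith [Real.exp_one_lt_three]
    have hm2 : (m : ℝ) ≤ (2 * m : ℕ) := by
      push_cast
      linarith
    generalize Real.log (2 * m : ℕ) = L at hl1 hl2
    have hD : (0 : ℝ) ≤ ((2 * d : ℕ) : ℝ) := Nat.cast_nonneg _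
    generalize ((2 * d : ℕ) : ℝ) = D at hD ⊢
    have h5 : 12 * D ^ 2 + 12 + 192 * D * Real.log m ≤ (12 * D ^ 2 + 12 + 192 * D) * L := by
      have := mul_le_mul_of_nonneg_left hl1 hD
      nlinarith [sq_nonneg D]
    calc (m : ℝ) * (12 * D ^ 2 + 12 + 192 * D * Real.log m)
        ≤ m * ((12 * D ^ 2 + 12 + 192 * D) * L) := by gcongr
      _ ≤ (2 * m : ℕ) * ((12 * D ^ 2 + 12 + 192 * D) * L) := by gcongr
      _ = _ := by ring
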